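/- Let S be a carpet in S² whose peripheral circles form a family of uniform quasicircles, let G be a group of homeomorphisms of S, and let Γ be a path family in S² with mod_{S/G}(Γ) < ∞. Suppose that for each k ∈ ℕ there exist a family 𝒞_k of peripheral circles of S and a constant N_k ∈ ℕ such that: (i) every orbit 𝒪 of peripheral circles of S under the action of G satisfies #(𝒪 ∩ 𝒞_k) ≤ N_k; and (ii) Γ = ⋃_k Γ_k, where Γ_k is the family of all paths in Γ that only meet peripheral circles belonging to 𝒞_k. Then an extremal invariant mass distribution for mod_{S/G}(Γ) exists: there is an invariant admissible ρ with mass_{S/G}(ρ) = mod_{S/G}(Γ). -/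

import Mathlib

open Set Metric

noncomputable section

/-- Level-`n` approximation `Q_n` of the standard `1/p`-Sierpiński carpet in `ℂ ≅ ℝ²`:
`Q_0` is the closed unit square, and `Q_{n+1}` is the union of the images of `Q_n` under
the `p² - 1` contractions `z ↦ (z + i + j·√-1)/p` with `(i,j)` ranging over all non-middle
positions; this is the usual subdivide-and-remove-middle-squares construction. -/
def carpetApprox (p : ℕ) : ℕ → Set ℂ
  | 0 => {z : ℂ | z.re ∈ Set.Icc (0:ℝ) 1 ∧ z.im ∈ Set.Icc (0:ℝ) 1}
  | n + 1 =>
      ⋃ (i : ℕ) (j : ℕ) (_ : i < p) (_ : j < p)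
        (_ : ¬(i = (p - 1) / 2 ∧ j = (p - 1) / 2)),
        (fun z : ℂ => (z + (i : ℂ) + (j : ℂ) * Complex.I) / (p : ℂ)) '' carpetApprox p n

/-- The standard `1/p`-Sierpiński carpet `S_p ⊆ ℝ² ≅ ℂ`. -/
def sierpinskiCarpet (p : ℕ) : Set ℂ := ⋂ n, carpetApprox p n

/-- `η : [0,∞) → [0,∞)` is a (self-)homeomorphism of `[0,∞)`: it is continuous, strictly
increasing on `[0,∞)`, fixes `0` and maps `[0,∞)` onto `[0,∞)`. -/
def IsQSControl (η : ℝ → ℝ) : Prop :=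
  ContinuousOn η (Set.Ici 0) ∧ StrictMonoOn η (Set.Ici 0) ∧ η 0 = 0 ∧
    Set.SurjOn η (Set.Ici 0) (Set.Ici 0)

/-- A map `f` between metric spaces is quasisymmetric: for some homeomorphism
`η : [0,∞) → [0,∞)` one has `d(f u, f v) ≤ η(d(u,v)/d(u,w)) · d(f u, f w)` for all `u,v,w`
with `u ≠ w`. -/
def IsQSMap {X Y : Type*} [MetricSpace X] [MetricSpace Y] (f : X → Y) : Prop :=
  ∃ η : ℝ → ℝ, IsQSControl η ∧
    ∀ u v w : X, u ≠ w → dist (f u) (f v) ≤ η (dist u v / dist u w) * dist (f u) (f w)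

/-- The boundary of the axis-parallel closed square with lower-left corner `c` and
side length `l`. -/
def squareBoundary (c : ℂ) (l : ℝ) : Set ℂ :=
  {z : ℂ | max |z.re - (c.re + l / 2)| |z.im - (c.im + l / 2)| = l / 2}

/-- The outer square `O = ∂([0,1]×[0,1])`. -/
def outerSquare : Set ℂ := squareBoundary 0 1

/-- The middle square `M = ∂([(p-1)/(2p),(p+1)/(2p)]²)`. -/
def middleSquare (p : ℕ) : Set ℂ :=
  squareBoundary ((((p : ℝ) - 1) / (2 * p) : ℝ) * (1 + Complex.I)) (1 / p)

end

open MeasureTheory Filter Topology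
open scoped ENNReal

noncomputable section

/-- The unit sphere `S² = {x ∈ ℝ³ : |x| = 1}`, with the metric induced from `ℝ³`. -/
def Sphere2 : Set (EuclideanSpace ℝ (Fin 3)) := Metric.sphere 0 1

/-- The `2`-dimensional Hausdorff measure `σ` on `S²`. -/
def sphereMeasure : Measure ↥Sphere2 := μH[2]

/-- A path in `S²`: a continuous map of a finite interval (of one of the four kinds
`[a,b]`, `[a,b)`, `(a,b]`, `(a,b)` with `a < b`) into `S²`. -/
structure SpherePath where
  /-- The parameter interval. -/
  I : Set ℝ
  /-- The parameter set is a finite interval. -/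
  hI : ∃ a b : ℝ, a < b ∧
    (I = Set.Icc a b ∨ I = Set.Ico a b ∨ I = Set.Ioc a b ∨ I = Set.Ioo a b)
  /-- The parametrizing map. -/
  toFun : ℝ → ↥Sphere2
  /-- Continuity on the parameter interval. -/
  cont : ContinuousOn toFun I

/-- The image of a path. -/
def SpherePath.image (γ : SpherePath) : Set ↥Sphere2 := γ.toFun '' γ.I

/-- A path is locally rectifiable if it has finite length (total variation) on every
compact subinterval of its parameter interval. -/
def SpherePath.LocRectifiable (γ : SpherePath) : Prop :=
  ∀ a b : ℝ, Set.Icc a b ⊆ γ.I → eVariationOn γ.toFun (Set.Icc a b) < ⊤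

/-- The arclength integral `∫ ρ ds` of a density `ρ` over the restriction of the curve
`f` to `[a,b]`, computed via the arclength parametrization: if `s(t)` denotes the length
of `f|[a,t]` and `L` the length of `f|[a,b]`, this is `∫₀ᴸ ρ(f(t(u))) du` where
`t(u) = inf{t ∈ [a,b] : s(t) ≥ u}`. -/
def arcIntegralOn (ρ : ↥Sphere2 → ℝ≥0∞) (f : ℝ → ↥Sphere2) (a b : ℝ) : ℝ≥0∞ :=
  ∫⁻ u in Set.Ico (0 : ℝ) (eVariationOn f (Set.Icc a b)).toReal,
    ρ (f (sInf {t | t ∈ Set.Icc a b ∧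
      ENNReal.ofReal u ≤ eVariationOn f (Set.Icc a t)}))

/-- The arclength integral `∫_γ ρ ds` of a density `ρ` along a path `γ`, defined as the
supremum of the arclength integrals over all compact subintervals of the parameter
interval. -/
def SpherePath.lineIntegral (γ : SpherePath) (ρ : ↥Sphere2 → ℝ≥0∞) : ℝ≥0∞ :=
  ⨆ (a : ℝ) (b : ℝ) (_ : Set.Icc a b ⊆ γ.I), arcIntegralOn ρ γ.toFun a b

/-- The conformal modulus `mod(Γ)` of a family of paths in `S²`: the infimum of
`∫ ρ² dσ` over all Borel densities `ρ : S² → [0,∞]` with `∫_γ ρ ds ≥ 1` for every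
locally rectifiable `γ ∈ Γ`. -/
def conformalModulus (Γ : Set SpherePath) : ℝ≥0∞ :=
  ⨅ (ρ : ↥Sphere2 → ℝ≥0∞) (_ : Measurable ρ)
    (_ : ∀ γ ∈ Γ, γ.LocRectifiable → 1 ≤ γ.lineIntegral ρ),
    ∫⁻ x, ρ x ^ 2 ∂sphereMeasure

/-- A carpet in `S²`: a subset homeomorphic to the standard Sierpiński carpet `S_3`. -/
def IsCarpet (S : Set ↥Sphere2) : Prop := Nonempty (↥S ≃ₜ ↥(sierpinskiCarpet 3))

/-- A peripheral circle of a carpet `S ⊆ S²`: a Jordan curve `C ⊆ S` (a subset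
homeomorphic to a circle) whose complement `S ∖ C` in `S` is connected. -/
def IsPeripheralCircle (S C : Set ↥Sphere2) : Prop :=
  C ⊆ S ∧ Nonempty (↥C ≃ₜ ↥(Metric.sphere (0 : ℂ) 1)) ∧ IsConnected (S \ C)

/-- `Σ_{C : γ ∩ C ≠ ∅} ρ(C)`: the total mass of the peripheral circles of `S` met by the
path `γ`. -/
def pathMassSum (S : Set ↥Sphere2) (ρ : Set ↥Sphere2 → ℝ≥0∞) (γ : SpherePath) : ℝ≥0∞ :=
  ∑' C : {C : Set ↥Sphere2 // IsPeripheralCircle S C ∧ (γ.image ∩ C).Nonempty}, ρ C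

/-- A mass distribution `ρ` on the peripheral circles of `S` is admissible for the carpet
modulus `mod_S(Γ)` if there is an exceptional family `Γ₀ ⊆ Γ` of conformal modulus zero
such that every `γ ∈ Γ ∖ Γ₀` meets peripheral circles of total mass at least `1`. -/
def CarpetAdmissible (S : Set ↥Sphere2) (Γ : Set SpherePath)
    (ρ : Set ↥Sphere2 → ℝ≥0∞) : Prop :=
  ∃ Γ₀ : Set SpherePath, Γ₀ ⊆ Γ ∧ conformalModulus Γ₀ = 0 ∧
    ∀ γ ∈ Γ \ Γ₀, 1 ≤ pathMassSum S ρ γ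

/-- The total mass `Σ_i ρ(C_i)²` of a mass distribution on the peripheral circles of a
carpet `S`. -/
def carpetMass (S : Set ↥Sphere2) (ρ : Set ↥Sphere2 → ℝ≥0∞) : ℝ≥0∞ :=
  ∑' C : {C : Set ↥Sphere2 // IsPeripheralCircle S C}, ρ C ^ 2

/-- The carpet modulus `mod_S(Γ)` of a path family `Γ` with respect to a carpet
`S ⊆ S²`. -/
def carpetModulus (S : Set ↥Sphere2) (Γ : Set SpherePath) : ℝ≥0∞ :=
  ⨅ (ρ : Set ↥Sphere2 → ℝ≥0∞) (_ : CarpetAdmissible S Γ ρ), carpetMass S ρ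

/-- A family of Jordan curves in `S²` consists of uniform quasicircles if there is a
single control function `η` such that each curve in the family is the image of the
Euclidean unit circle under an `η`-quasisymmetric map. -/
def UniformQuasicircles (𝒞 : Set (Set ↥Sphere2)) : Prop :=
  ∃ η : ℝ → ℝ, IsQSControl η ∧ ∀ C ∈ 𝒞,
    ∃ f : ↥(Metric.sphere (0 : ℂ) 1) → ↥Sphere2, Set.range f = C ∧
      Function.Injective f ∧
      ∀ u v w : ↥(Metric.sphere (0 : ℂ) 1), u ≠ w →
        dist (f u) (f v) ≤ η (dist u v / dist u w) * dist (f u) (f w)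

end

noncomputable section

/-- The image of a subset `C` of a carpet `S` under a self-homeomorphism `g` of `S`,
as a subset of `S²`. -/
def setImage (S : Set ↥Sphere2) (g : ↥S ≃ₜ ↥S) (C : Set ↥Sphere2) : Set ↥Sphere2 :=
  Subtype.val '' (g '' (Subtype.val ⁻¹' C))

/-- `G ⊆ Homeo(S)` is a group of homeomorphisms of `S`: it contains the identity and is
closed under composition and inversion. -/
def IsHomeoGroup (S : Set ↥Sphere2) (G : Set (↥S ≃ₜ ↥S)) : Prop :=
  Homeomorph.refl ↥S ∈ G ∧ (∀ g ∈ G, ∀ h ∈ G, g.trans h ∈ G) ∧ ∀ g ∈ G, g.symm ∈ G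

/-- The orbit of a peripheral circle `C` of `S` under the action of a group `G` of
homeomorphisms of `S`. -/
def periphOrbit (S : Set ↥Sphere2) (G : Set (↥S ≃ₜ ↥S)) (C : Set ↥Sphere2) :
    Set (Set ↥Sphere2) :=
  {C' | ∃ g ∈ G, C' = setImage S g C}

/-- The set of all orbits of peripheral circles of `S` under the action of `G`. -/
def periphOrbitSet (S : Set ↥Sphere2) (G : Set (↥S ≃ₜ ↥S)) : Set (Set (Set ↥Sphere2)) :=
  {O | ∃ C : Set ↥Sphere2, IsPeripheralCircle S C ∧ O = periphOrbit S G C}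

/-- A mass distribution `ρ` on the peripheral circles of `S` is invariant under `G` if it
takes the same value on each peripheral circle in the same orbit. -/
def InvariantMass (S : Set ↥Sphere2) (G : Set (↥S ≃ₜ ↥S))
    (ρ : Set ↥Sphere2 → ℝ≥0∞) : Prop :=
  ∀ g ∈ G, ∀ C : Set ↥Sphere2, IsPeripheralCircle S C → ρ (setImage S g C) = ρ C

/-- The total mass `mass_{S/G}(ρ) = Σ_𝒪 ρ(𝒪)²` of an invariant mass distribution, where
the sum extends over all orbits `𝒪` of peripheral circles of `S` under `G` and `ρ(𝒪)`
is the common value of `ρ` on the circles in `𝒪`. -/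
def groupMass (S : Set ↥Sphere2) (G : Set (↥S ≃ₜ ↥S)) (ρ : Set ↥Sphere2 → ℝ≥0∞) :
    ℝ≥0∞ :=
  ∑' O : ↥(periphOrbitSet S G), ⨆ C ∈ O.1, ρ C ^ 2

/-- The carpet modulus `mod_{S/G}(Γ)` of a path family `Γ` with respect to the action of
a group `G` of homeomorphisms of the carpet `S`: the infimum of `mass_{S/G}(ρ)` over all
invariant admissible mass distributions `ρ`. -/
def groupCarpetModulus (S : Set ↥Sphere2) (G : Set (↥S ≃ₜ ↥S)) (Γ : Set SpherePath) :
    ℝ≥0∞ :=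
  ⨅ (ρ : Set ↥Sphere2 → ℝ≥0∞) (_ : InvariantMass S G ρ)
    (_ : CarpetAdmissible S Γ ρ), groupMass S G ρ

end

/-! ### Continuous logarithms -/

theorem exists_continuous_log_of_homotopy {A : Type*} [TopologicalSpace A]
    (H : unitInterval × A → ℂ) (hH : Continuous H) (hne : ∀ x, H x ≠ 0)
    (L₀ : A → ℂ) (hL₀ : Continuous L₀) (h0 : ∀ a, Complex.exp (L₀ a) = H (0, a)) :
    ∃ L : A → ℂ, Continuous L ∧ ∀ a, Complex.exp (L a) = H (1, a) := by
  let H' : C(unitInterval × A, {z : ℂ // z ≠ 0}) := ⟨fun x => ⟨H x, hne x⟩, by fun_prop⟩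
  have hH0 : ∀ a, H' (0, a) = (fun z : ℂ ↦ (⟨_, z.exp_ne_zero⟩ : {z : ℂ // z ≠ 0}))
      ((⟨L₀, hL₀⟩ : C(A, ℂ)) a) := fun a => Subtype.ext (h0 a).symm
  refine ⟨fun a => Complex.isCoveringMap_exp.liftHomotopy H' ⟨L₀, hL₀⟩ hH0 (1, a),
    by fun_prop, fun a => ?_⟩
  have := congr_fun (Complex.isCoveringMap_exp.liftHomotopy_lifts H' ⟨L₀, hL₀⟩ hH0) (1, a)
  exact congrArg Subtype.val this

theorem exists_continuous_log {E : Type*} [NormedAddCommGroup E] [NormedSpace ℝ E]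
    (f : E → ℂ) (hf : Continuous f) (hne : ∀ v, f v ≠ 0) :
    ∃ L : E → ℂ, Continuous L ∧ ∀ v, Complex.exp (L v) = f v := by
  obtain ⟨L, hL, h⟩ := exists_continuous_log_of_homotopy (A := E)
    (fun x => f ((x.1 : ℝ) • x.2)) (by fun_prop) (fun _ => hne _)
    (fun _ => Complex.log (f 0)) (by fun_prop) (fun a => by simp [Complex.exp_log (hne 0)])
  exact ⟨L, hL, by simpa using h⟩

theorem eq_of_exp_comp_eq {A : Type*} [TopologicalSpace A] [PreconnectedSpace A]
    {L₁ L₂ : A → ℂ} (h₁ : Continuous L₁) (h₂ : Continuous L₂)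
    (h : ∀ a, Complex.exp (L₁ a) = Complex.exp (L₂ a)) {a₀ : A} (h₀ : L₁ a₀ = L₂ a₀) :
    L₁ = L₂ :=
  Complex.isCoveringMap_exp.eq_of_comp_eq h₁ h₂ (funext fun a => Subtype.ext (h a)) a₀ h₀

/-! ### The Riemann sphere -/

noncomputable section

/-- The map `w ↦ 1 / (w - q)` on the Riemann sphere, with value `0` at `∞`. -/
def poleMap (q : ℂ) (z : OnePoint ℂ) : ℂ := z.elim 0 (fun w => (w - q)⁻¹)

/-- The Möbius map `w ↦ (w - p) / (w - q)` on the Riemann sphere minus `q`. -/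
def mobiusQuot (p q : ℂ) (z : OnePoint ℂ) : ℂ := 1 + (q - p) * poleMap q z

/-- The inverse of `poleMap q`. -/
def poleMapInv (q : ℂ) (v : ℂ) : OnePoint ℂ :=
  if v = 0 then OnePoint.infty else ((q + v⁻¹ : ℂ) : OnePoint ℂ)

end

theorem continuousAt_poleMap {q : ℂ} {z : OnePoint ℂ} (hz : z ≠ (q : OnePoint ℂ)) :
    ContinuousAt (fun x : ℂ × OnePoint ℂ => poleMap x.1 x.2) (q, z) := by
  induction z using OnePoint.rec with
  | infty =>
    rw [ContinuousAt, nhds_prod_eq, OnePoint.nhds_infty_eq, prod_sup, tendsto_sup]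
    constructor
    · rw [prod_map_right, tendsto_map'_iff]
      change Tendsto (fun x : ℂ × ℂ => (x.2 - x.1)⁻¹) _ (𝓝 0)
      refine tendsto_inv₀_cobounded.comp ?_
      rw [coclosedCompact_eq_cocompact, ← Metric.cobounded_eq_cocompact,
        ← tendsto_norm_atTop_iff_cobounded]
      have h1 : Tendsto (fun x : ℂ × ℂ => ‖x.2‖) (𝓝 q ×ˢ Bornology.cobounded ℂ) atTop :=
        tendsto_norm_cobounded_atTop.comp tendsto_snd
      have h2 : Tendsto (fun x : ℂ × ℂ => -‖x.1‖) (𝓝 q ×ˢ Bornology.cobounded ℂ) (𝓝 (-‖q‖)) :=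
        (continuous_norm.neg.tendsto q).comp tendsto_fst
      refine tendsto_atTop_mono (fun x => ?_) (h1.atTop_add h2)
      have := norm_sub_norm_le x.2 x.1
      linarith
    · rw [prod_pure, tendsto_map'_iff]
      exact tendsto_const_nhds
  | coe w =>
    have hw : w - q ≠ 0 := fun h => hz (by rw [sub_eq_zero.1 h])
    rw [ContinuousAt, nhds_prod_eq, OnePoint.nhds_coe_eq, prod_map_right, tendsto_map'_iff,
      ← nhds_prod_eq]
    change Tendsto (fun x : ℂ × ℂ => (x.2 - x.1)⁻¹) _ (𝓝 ((w - q)⁻¹))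
    exact ContinuousAt.inv₀ (f := fun x : ℂ × ℂ => x.2 - x.1) (a := (q, w)) (by fun_prop) hw

theorem continuousAt_mobiusQuot {p q : ℂ} {z : OnePoint ℂ} (hz : z ≠ (q : OnePoint ℂ)) :
    ContinuousAt (fun x : ℂ × OnePoint ℂ => mobiusQuot p x.1 x.2) (q, z) := by
  unfold mobiusQuot
  exact continuousAt_const.add
    ((continuousAt_fst.sub continuousAt_const).mul (continuousAt_poleMap hz))

theorem continuousAt_mobiusQuot_right {p q : ℂ} {z : OnePoint ℂ} (hz : z ≠ (q : OnePoint ℂ)) :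
    ContinuousAt (mobiusQuot p q) z :=
  ContinuousAt.comp (f := fun z => (q, z)) (x := z) (continuousAt_mobiusQuot hz) (by fun_prop)

theorem mobiusQuot_ne_zero {p q : ℂ} {z : OnePoint ℂ} (hp : z ≠ (p : OnePoint ℂ))
    (hq : z ≠ (q : OnePoint ℂ)) : mobiusQuot p q z ≠ 0 := by
  induction z using OnePoint.rec with
  | infty => simp [mobiusQuot, poleMap]
  | coe w =>
    have hwq : w - q ≠ 0 := fun h => hq (by rw [sub_eq_zero.1 h])
    have hwp : w - p ≠ 0 := fun h => hp (by rw [sub_eq_zero.1 h])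
    have : mobiusQuot p q w = (w - p) / (w - q) := by
      simp only [mobiusQuot, poleMap, OnePoint.elim_some]
      field_simp
      ring
    rw [this]
    exact div_ne_zero hwp hwq

theorem poleMap_poleMapInv (q v : ℂ) : poleMap q (poleMapInv q v) = v := by
  by_cases hv : v = 0
  · simp [poleMapInv, poleMap, hv]
  · simp [poleMapInv, poleMap, hv]

theorem poleMapInv_ne (q v : ℂ) : poleMapInv q v ≠ (q : OnePoint ℂ) := by
  by_cases hv : v = 0
  · simp [poleMapInv, hv]
  · simp [poleMapInv, hv]

theorem continuous_poleMapInv (q : ℂ) : Continuous (poleMapInv q) := by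
  rw [continuous_iff_continuousAt]
  intro v
  by_cases hv : v = 0
  · subst hv
    rw [continuousAt_iff_punctured_nhds]
    have h : Tendsto (fun v : ℂ => ((q + v⁻¹ : ℂ) : OnePoint ℂ)) (𝓝[≠] 0)
        (𝓝 (OnePoint.infty : OnePoint ℂ)) := by
      have h1 : Tendsto (fun v : ℂ => q + v⁻¹) (𝓝[≠] 0) (coclosedCompact ℂ) := by
        rw [coclosedCompact_eq_cocompact, ← Metric.cobounded_eq_cocompact]
        exact (tendsto_const_add_cobounded q).comp tendsto_inv₀_nhdsNE_zero
      exact OnePoint.tendsto_coe_infty.comp h1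
    have h0 : poleMapInv q 0 = OnePoint.infty := by simp [poleMapInv]
    rw [h0]
    refine h.congr' ?_
    filter_upwards [self_mem_nhdsWithin] with v hv
    exact (if_neg hv).symm
  · have h : ContinuousAt (fun v : ℂ => ((q + v⁻¹ : ℂ) : OnePoint ℂ)) v :=
      OnePoint.continuous_coe.continuousAt.comp
        (continuousAt_const.add (continuousAt_inv₀ hv))
    refine h.congr ?_
    filter_upwards [isOpen_ne.mem_nhds hv] with v hv
    exact (if_neg hv).symm

/-- A nowhere vanishing continuous function on the plane cannot agree with a nonconstant affine
function near infinity. -/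
theorem not_eventually_affine {f : ℂ → ℂ} (hf : Continuous f) (hne : ∀ v, f v ≠ 0) {c : ℂ}
    (hc : c ≠ 0) (h : ∀ᶠ v in Bornology.cobounded ℂ, f v = 1 + c * v) : False := by
  obtain ⟨L, hL, hexp⟩ := exists_continuous_log f hf hne
  obtain ⟨R, -, hR⟩ := (hasBasis_cobounded_norm (E := ℂ)).eventually_iff.1 h
  set M : ℝ := ‖c‖ * |R| + 1 with hM
  have hMpos : 0 < M := by positivity
  let v : ℝ → ℂ := fun θ => (M * Complex.exp (θ * Complex.I) - 1) / c
  have hv : Continuous v := by fun_prop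
  have hnorm : ∀ θ, R ≤ ‖v θ‖ := by
    intro θ
    have h1 : ‖(M : ℂ) * Complex.exp (θ * Complex.I)‖ = M := by
      rw [norm_mul, Complex.norm_exp_ofReal_mul_I, mul_one, Complex.norm_real,
        Real.norm_of_nonneg hMpos.le]
    have h2 : M - 1 ≤ ‖(M : ℂ) * Complex.exp (θ * Complex.I) - 1‖ := by
      have := norm_sub_norm_le ((M : ℂ) * Complex.exp (θ * Complex.I)) 1
      rw [h1, norm_one] at this
      exact this
    have hcpos : 0 < ‖c‖ := norm_pos_iff.2 hc
    rw [norm_div, le_div_iff₀ hcpos]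
    have := mul_le_mul_of_nonneg_left (le_abs_self R) hcpos.le
    linarith
  have hval : ∀ θ, Complex.exp (L (v θ)) = M * Complex.exp (θ * Complex.I) := by
    intro θ
    rw [hexp, hR (hnorm θ)]
    simp only [v]
    field_simp
    ring
  have key := eq_of_exp_comp_eq (L₁ := fun θ : ℝ => L (v θ))
    (L₂ := fun θ : ℝ => L (v 0) + θ * Complex.I) (a₀ := 0) (by fun_prop) (by fun_prop)
    (fun θ => by rw [hval, Complex.exp_add, hval]; simp) (by simp)
  have h2 := congr_fun key (2 * Real.pi)
  have h3 : v (2 * Real.pi) = v 0 := by simp [v, Complex.exp_two_pi_mul_I]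
  simp [h3, Real.pi_ne_zero] at h2

theorem OnePoint.no_log_mobiusQuot_on_frontier {p q : ℂ} {W : Set (OnePoint ℂ)}
    (hp : (p : OnePoint ℂ) ∈ W) (hq : (q : OnePoint ℂ) ∉ closure W)
    {L : OnePoint ℂ → ℂ} (hL : ContinuousOn L (frontier W))
    (hexp : ∀ z ∈ frontier W, Complex.exp (L z) = mobiusQuot p q z) : False := by
  classical
  obtain ⟨g, hg⟩ := ContinuousMap.exists_restrict_eq (Y := ℂ) isClosed_frontier
    ⟨(frontier W).domRestrict L, hL.domRestrict⟩
  have hgL : ∀ z ∈ frontier W, g z = L z := fun z hz => DFunLike.congr_fun hg ⟨z, hz⟩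
  let G : OnePoint ℂ → ℂ := fun z => if z ∈ closure W then Complex.exp (g z) else mobiusQuot p q z
  have hG : ContinuousOn G {(q : OnePoint ℂ)}ᶜ := by
    refine ContinuousOn.if ?_ (by fun_prop) ?_
    · rintro a ⟨-, ha⟩
      have ha' : a ∈ frontier W := frontier_closure_subset ha
      rw [hgL a ha', hexp a ha']
    · intro z hz
      exact (continuousAt_mobiusQuot_right (fun h => hz.1 h)).continuousWithinAt
  have hGne : ∀ z, z ≠ (q : OnePoint ℂ) → G z ≠ 0 := by
    intro z hz
    by_cases h : z ∈ closure W
    · simp [G, h, Complex.exp_ne_zero]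
    · simp only [G, h, if_false]
      exact mobiusQuot_ne_zero (fun h' => h (h' ▸ subset_closure hp)) hz
  have hpq : q - p ≠ 0 := by
    intro h
    rw [sub_eq_zero.1 h] at hq
    exact hq (subset_closure hp)
  refine not_eventually_affine (f := fun v => G (poleMapInv q v))
    (hG.comp_continuous (continuous_poleMapInv q) (fun v => poleMapInv_ne q v))
    (fun v => hGne _ (poleMapInv_ne q v)) hpq ?_
  have hlim : Tendsto (poleMapInv q) (Bornology.cobounded ℂ) (𝓝 (q : OnePoint ℂ)) := by
    have h1 : Tendsto (fun v : ℂ => ((q + v⁻¹ : ℂ) : OnePoint ℂ)) (Bornology.cobounded ℂ)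
        (𝓝 (q : OnePoint ℂ)) := by
      refine (OnePoint.continuous_coe.tendsto q).comp ?_
      simpa using tendsto_const_nhds (x := q).add (tendsto_inv₀_cobounded (α := ℂ))
    refine h1.congr' ?_
    filter_upwards [Bornology.eventually_ne_cobounded (0 : ℂ)] with v hv
    exact (if_neg hv).symm
  filter_upwards [hlim (isClosed_closure.isOpen_compl.mem_nhds hq)] with v hv
  have hv' : poleMapInv q v ∉ closure W := hv
  simp only [G, hv', if_false, mobiusQuot, poleMap_poleMapInv]

section Transport

variable {X : Type*} [TopologicalSpace X] (e : X ≃ₜ OnePoint ℂ)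

theorem no_log_mobiusQuot_on_frontier {p q : ℂ} {W : Set X}
    (hp : e.symm p ∈ W) (hq : e.symm q ∉ closure W)
    {L : X → ℂ} (hL : ContinuousOn L (frontier W))
    (hexp : ∀ z ∈ frontier W, Complex.exp (L z) = mobiusQuot p q (e z)) : False := by
  have hfr : frontier (e.symm ⁻¹' W) = e.symm ⁻¹' frontier W := (e.symm.preimage_frontier W).symm
  refine OnePoint.no_log_mobiusQuot_on_frontier (p := p) (q := q) (W := e.symm ⁻¹' W)
    (L := fun z => L (e.symm z)) hp ?_ ?_ ?_
  · rw [← e.symm.preimage_closure]; exact hq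
  · rw [hfr]
    exact hL.comp e.symm.continuous.continuousOn (fun z hz => hz)
  · intro z hz
    rw [hfr] at hz
    rw [hexp _ hz, e.apply_symm_apply]

theorem exists_log_mobiusQuot_off_path (a : unitInterval → ℂ) (ha : Continuous a) :
    ∃ L : X → ℂ, ContinuousOn L (range fun t => e.symm (a t))ᶜ ∧
      ∀ z ∈ (range fun t => e.symm (a t))ᶜ,
        Complex.exp (L z) = mobiusQuot (a 0) (a 1) (e z) := by
  classical
  set A : Set X := (range fun t => e.symm (a t))ᶜ with hA
  have hne : ∀ (t : unitInterval) (z : A), e z ≠ (a t : OnePoint ℂ) := fun t z h =>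
    z.2 ⟨t, by simp [← h]⟩
  obtain ⟨L, hL, hexp⟩ := exists_continuous_log_of_homotopy (A := A)
    (fun x => mobiusQuot (a 0) (a x.1) (e x.2)) (by
      rw [continuous_iff_continuousAt]
      rintro ⟨t, z⟩
      exact ContinuousAt.comp (f := fun x : unitInterval × A => (a x.1, e x.2))
        (continuousAt_mobiusQuot (hne t z)) (by fun_prop))
    (fun x => mobiusQuot_ne_zero (hne _ _) (hne _ _)) (fun _ => 0) continuous_const
    (fun z => by simp [mobiusQuot])
  refine ⟨fun z => if h : z ∈ A then L ⟨z, h⟩ else 0, ?_, fun z hz => ?_⟩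
  · rw [continuousOn_iff_continuous_domRestrict]
    convert hL using 1
    ext z
    simp
  · simp only [hz, dif_pos]
    exact hexp ⟨z, hz⟩

/-- Two closed sets containing paths with common endpoints, whose intersection does not meet
the frontier of an open set separating the endpoints, have disconnected complement. -/
theorem not_isPreconnected_compl_union {A B W : Set X} (hA : IsClosed A) (hB : IsClosed B)
    {a b : unitInterval → X} (ha : Continuous a) (hb : Continuous b)
    (haA : ∀ t, a t ∈ A) (hbB : ∀ t, b t ∈ B) (h0 : a 0 = b 0) (h1 : a 1 = b 1)
    (haN : ∀ t, e (a t) ≠ OnePoint.infty) (hbN : ∀ t, e (b t) ≠ OnePoint.infty)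
    (haW : a 0 ∈ W) (haW' : a 1 ∉ closure W) (hfr : Disjoint (frontier W) (A ∩ B)) :
    ¬ IsPreconnected (A ∪ B)ᶜ := by
  classical
  intro hU
  have lift : ∀ c : unitInterval → X, Continuous c → (∀ t, e (c t) ≠ OnePoint.infty) →
      ∃ c' : unitInterval → ℂ, Continuous c' ∧ ∀ t, (c' t : OnePoint ℂ) = e (c t) := by
    intro c hc hcN
    choose c' hc' using fun t => OnePoint.ne_infty_iff_exists.1 (hcN t)
    refine ⟨c', ?_, hc'⟩
    rw [OnePoint.isOpenEmbedding_coe.isInducing.continuous_iff]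
    have : (OnePoint.some : ℂ → OnePoint ℂ) ∘ c' = fun t => e (c t) := funext hc'
    rw [this]
    fun_prop
  obtain ⟨a', ha', haa⟩ := lift a ha haN
  obtain ⟨b', hb', hbb⟩ := lift b hb hbN
  have ha0 : a' 0 = b' 0 := OnePoint.coe_injective (by rw [haa, hbb, h0])
  have ha1 : a' 1 = b' 1 := OnePoint.coe_injective (by rw [haa, hbb, h1])
  obtain ⟨La, hLa, hea⟩ := exists_log_mobiusQuot_off_path e a' ha'
  obtain ⟨Lb, hLb, heb⟩ := exists_log_mobiusQuot_off_path e b' hb'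
  simp only [haa, hbb, e.symm_apply_apply, ← ha0, ← ha1] at hLa hea hLb heb
  have hAc : Aᶜ ⊆ (range fun t => a t)ᶜ := compl_subset_compl.2 (range_subset_iff.2 haA)
  have hBc : Bᶜ ⊆ (range fun t => b t)ᶜ := compl_subset_compl.2 (range_subset_iff.2 hbB)
  obtain ⟨k, hk, hke⟩ : ∃ k : ℂ, Complex.exp k = 1 ∧ ∀ z ∈ (A ∪ B)ᶜ, La z = Lb z + k := by
    rcases ((A ∪ B)ᶜ).eq_empty_or_nonempty with hemp | ⟨z₀, hz₀⟩
    · exact ⟨0, by simp, by simp [hemp]⟩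
    · have hzz : ∀ z ∈ (A ∪ B)ᶜ, Complex.exp (La z) = Complex.exp (Lb z) := fun z hz => by
        rw [hea z (hAc fun h => hz (Or.inl h)), heb z (hBc fun h => hz (Or.inr h))]
      refine ⟨La z₀ - Lb z₀, by rw [Complex.exp_sub, hzz z₀ hz₀, div_self (Complex.exp_ne_zero _)],
        ?_⟩
      have : PreconnectedSpace ((A ∪ B)ᶜ : Set X) := isPreconnected_iff_preconnectedSpace.1 hU
      have hsa : (A ∪ B)ᶜ ⊆ (range fun t => a t)ᶜ := fun z hz => hAc fun h => hz (Or.inl h)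
      have hsb : (A ∪ B)ᶜ ⊆ (range fun t => b t)ᶜ := fun z hz => hBc fun h => hz (Or.inr h)
      have key := eq_of_exp_comp_eq (A := ((A ∪ B)ᶜ : Set X)) (L₁ := fun z => La z)
        (L₂ := fun z => Lb z + (La z₀ - Lb z₀)) (a₀ := ⟨z₀, hz₀⟩)
        (hLa.mono hsa).domRestrict ((hLb.mono hsb).domRestrict.add continuous_const)
        (fun z => by
          rw [Complex.exp_add, Complex.exp_sub, hzz z₀ hz₀, div_self (Complex.exp_ne_zero _),
            mul_one, hzz z z.2]) (by ring)
      exact fun z hz => congr_fun key ⟨z, hz⟩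
  let L : X → ℂ := fun z => if z ∈ A then Lb z + k else La z
  have hLA : ∀ z ∈ Aᶜ, L z = La z := fun z hz => if_neg hz
  have hLB : ∀ z ∈ Bᶜ, L z = Lb z + k := by
    intro z hz
    by_cases hzA : z ∈ A
    · exact if_pos hzA
    · rw [hLA z hzA, hke z (by simp [hzA]; exact hz)]
  refine no_log_mobiusQuot_on_frontier e (p := a' 0) (q := a' 1) (W := W) (L := L)
    (by simpa [haa] using haW) (by simpa [haa] using haW') ?_ ?_
  · intro z hz
    by_cases hzA : z ∈ A
    · have hzB : z ∈ Bᶜ := fun h => Set.disjoint_left.1 hfr hz ⟨hzA, h⟩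
      have hc : ContinuousAt (fun z => Lb z + k) z :=
        ((hLb.mono hBc).continuousAt (hB.isOpen_compl.mem_nhds hzB)).add continuousAt_const
      refine (hc.congr ?_).continuousWithinAt
      filter_upwards [hB.isOpen_compl.mem_nhds hzB] with y hy
      exact (hLB y hy).symm
    · have hc : ContinuousAt La z := (hLa.mono hAc).continuousAt (hA.isOpen_compl.mem_nhds hzA)
      refine (hc.congr ?_).continuousWithinAt
      filter_upwards [hA.isOpen_compl.mem_nhds hzA] with y hy
      exact (hLA y hy).symm
  · intro z hz
    by_cases hzA : z ∈ A
    · have hzB : z ∈ Bᶜ := fun h => Set.disjoint_left.1 hfr hz ⟨hzA, h⟩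
      rw [hLB z hzB, Complex.exp_add, hk, mul_one, heb z (hBc hzB)]
    · rw [hLA z hzA, hea z (hAc hzA)]

/-- A proper part of a Jordan curve does not separate the sphere. -/
theorem not_frontier_subset_jordan_diff [T2Space X] {f : sphere (0 : ℂ) 1 → X} (hf : Continuous f)
    (hinj : Function.Injective f) {u₀ : sphere (0 : ℂ) 1} {W : Set X}
    (hfr : frontier W ⊆ range f \ {f u₀}) {x y : X} (hx : x ∈ W) (hxC : x ∉ range f)
    (hy : y ∉ closure W) (hyC : y ∉ range f) (hxN : e x ≠ OnePoint.infty)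
    (hyN : e y ≠ OnePoint.infty) : False := by
  obtain ⟨p, hp⟩ := OnePoint.ne_infty_iff_exists.1 hxN
  obtain ⟨q, hq⟩ := OnePoint.ne_infty_iff_exists.1 hyN
  have hpx : e.symm p = x := by rw [hp, e.symm_apply_apply]
  have hqy : e.symm q = y := by rw [hq, e.symm_apply_apply]
  have hu0 : (u₀ : ℂ) ≠ 0 := fun h => by simpa [h] using u₀.2
  have hmem : ∀ θ : ℝ, -(u₀ : ℂ) * Complex.exp (θ * Complex.I) ∈ sphere (0 : ℂ) 1 := by
    intro θ
    have := u₀.2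
    simp only [mem_sphere_iff_norm, sub_zero] at this ⊢
    rw [norm_mul, norm_neg, this, Complex.norm_exp_ofReal_mul_I, one_mul]
  let c : ℝ → sphere (0 : ℂ) 1 := fun θ => ⟨-(u₀ : ℂ) * Complex.exp (θ * Complex.I), hmem θ⟩
  have hc : Continuous c := by fun_prop
  have hcp : ∀ θ, e (f (c θ)) ≠ (p : OnePoint ℂ) := fun θ h =>
    hxC ⟨c θ, e.injective (h.trans hp)⟩
  have hcq : ∀ θ, e (f (c θ)) ≠ (q : OnePoint ℂ) := fun θ h =>
    hyC ⟨c θ, e.injective (h.trans hq)⟩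
  obtain ⟨ℓ, hℓ, hexp⟩ := exists_continuous_log (fun θ : ℝ => mobiusQuot p q (e (f (c θ)))) (by
      rw [continuous_iff_continuousAt]
      intro θ
      exact ContinuousAt.comp (f := fun θ : ℝ => e (f (c θ)))
        (continuousAt_mobiusQuot_right (hcq θ)) (by fun_prop))
    (fun θ => mobiusQuot_ne_zero (hcp θ) (hcq θ))
  have hemb : IsEmbedding f := (hf.isClosedEmbedding hinj).isEmbedding
  let φ := hemb.toHomeomorph.symm
  have hφ : ∀ u, φ ⟨f u, mem_range_self u⟩ = u := fun u => hemb.toHomeomorph.symm_apply_apply u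
  classical
  let L : X → ℂ := fun z => if h : z ∈ range f then ℓ (Complex.arg (-(φ ⟨z, h⟩ : ℂ) / u₀)) else 0
  have hLf : ∀ u, L (f u) = ℓ (Complex.arg (-(u : ℂ) / u₀)) := by
    intro u
    simp only [L, mem_range_self, dif_pos, hφ]
  refine no_log_mobiusQuot_on_frontier e (p := p) (q := q) (L := L) (hpx ▸ hx) (hqy ▸ hy)
    (ContinuousOn.mono ?_ hfr) ?_
  · rw [continuousOn_iff_continuous_domRestrict]
    have h1 : (range f \ {f u₀}).domRestrict L = fun z : (range f \ {f u₀} : Set X) =>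
        ℓ (Complex.arg (-(φ ⟨z, z.2.1⟩ : ℂ) / u₀)) := by
      ext z
      exact dif_pos z.2.1
    rw [h1]
    refine hℓ.comp ?_
    rw [continuous_iff_continuousAt]
    intro z
    refine ContinuousAt.comp (f := fun z : (range f \ {f u₀} : Set X) =>
        -(φ ⟨z, z.2.1⟩ : ℂ) / u₀) (Complex.continuousAt_arg ?_) (by fun_prop)
    obtain ⟨z, ⟨u, rfl⟩, hz⟩ := z
    have hu : u ≠ u₀ := fun h => hz (by simp [h])
    rw [hφ]
    have hn : ‖-(u : ℂ) / u₀‖ = 1 := by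
      have h1 := u.2
      have h2 := u₀.2
      simp only [mem_sphere_iff_norm, sub_zero] at h1 h2
      rw [norm_div, norm_neg, h1, h2, div_one]
    rw [Complex.mem_slitPlane_iff_arg]
    refine ⟨fun harg => hu ?_, fun h => by simp [h] at hn⟩
    have h3 := Complex.norm_mul_exp_arg_mul_I (-(u : ℂ) / u₀)
    rw [hn, harg, Complex.exp_pi_mul_I] at h3
    apply Subtype.ext
    field_simp at h3
    simpa using h3.symm
  · intro z hz
    obtain ⟨⟨u, rfl⟩, -⟩ := hfr hz
    rw [hLf, hexp]
    congr 3
    apply Subtype.ext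
    have hn : ‖-(u : ℂ) / u₀‖ = 1 := by
      have h1 := u.2
      have h2 := u₀.2
      simp only [mem_sphere_iff_norm, sub_zero] at h1 h2
      rw [norm_div, norm_neg, h1, h2, div_one]
    have h3 := Complex.norm_mul_exp_arg_mul_I (-(u : ℂ) / u₀)
    rw [hn, Complex.ofReal_one, one_mul] at h3
    simp only [c]
    rw [h3]
    field_simp

end Transport

/-- The plane tangent to the sphere at `z`, identified with `ℂ`. -/
noncomputable def tangentPlane (z : Sphere2) : ℂ ≃ₗᵢ[ℝ] (ℝ ∙ (z : EuclideanSpace ℝ (Fin 3)))ᗮ :=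
  have : Fact (Module.finrank ℝ (EuclideanSpace ℝ (Fin 3)) = 2 + 1) := ⟨by simp⟩
  Complex.orthonormalBasisOneI.repr.trans (OrthonormalBasis.fromOrthogonalSpanSingleton 2
    (ne_zero_of_mem_unit_sphere (⟨z, z.2⟩ : sphere (0 : EuclideanSpace ℝ (Fin 3)) 1))).repr.symm

theorem norm_coe_sphere2 (z : Sphere2) : ‖(z : EuclideanSpace ℝ (Fin 3))‖ = 1 :=
  mem_sphere_zero_iff_norm.1 z.2

theorem tangentPlane_inner (z : Sphere2) (w : ℂ) :
    inner ℝ (z : EuclideanSpace ℝ (Fin 3)) (tangentPlane z w : EuclideanSpace ℝ (Fin 3)) = 0 :=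
  Submodule.mem_orthogonal_singleton_iff_inner_right.1 (tangentPlane z w).2

theorem exists_homeomorph_onePoint (N : Sphere2) :
    ∃ e : Sphere2 ≃ₜ OnePoint ℂ, e N = OnePoint.infty := by
  have : CompactSpace Sphere2 := isCompact_iff_compactSpace.1 (isCompact_sphere _ _)
  let f : ℂ → Sphere2 := fun w => (stereographic (norm_coe_sphere2 N)).symm (tangentPlane N w)
  have hf : IsEmbedding f := (isOpenEmbedding_stereographic_symm (norm_coe_sphere2 N)).isEmbedding.comp
    (tangentPlane N).toHomeomorph.isEmbedding
  have hr : range f = {N}ᶜ := by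
    have h1 : range f = range ((stereographic (norm_coe_sphere2 N)).symm) :=
      (tangentPlane N).surjective.range_comp _
    exact h1.trans (range_stereographic_symm (norm_coe_sphere2 N) N.2)
  let E := OnePoint.equivOfIsEmbeddingOfRangeEq N f hf hr
  refine ⟨E.symm, ?_⟩
  rw [Homeomorph.symm_apply_eq]
  exact (OnePoint.equivOfIsEmbeddingOfRangeEq_apply_infty N f hf hr).symm

theorem norm_normalize_sub_le {E : Type*} [NormedAddCommGroup E] [NormedSpace ℝ E] {x y : E}
    (hx : 1 ≤ ‖x‖) (hy : 1 ≤ ‖y‖) : ‖‖x‖⁻¹ • x - ‖y‖⁻¹ • y‖ ≤ 2 * ‖x - y‖ := by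
  have hx0 : 0 < ‖x‖ := by linarith
  have hy0 : 0 < ‖y‖ := by linarith
  have h1 : ‖x‖⁻¹ • x - ‖y‖⁻¹ • y = ‖x‖⁻¹ • (x - y) + (‖x‖⁻¹ * (‖y‖ - ‖x‖)) • (‖y‖⁻¹ • y) := by
    have : ‖x‖⁻¹ * (‖y‖ - ‖x‖) * ‖y‖⁻¹ = ‖x‖⁻¹ - ‖y‖⁻¹ := by field_simp
    rw [smul_smul, this, smul_sub, sub_smul]
    abel
  have h2 : ‖‖y‖⁻¹ • y‖ = 1 := by
    rw [norm_smul, norm_inv, norm_norm, inv_mul_cancel₀ hy0.ne']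
  have h3 : ‖x‖⁻¹ ≤ 1 := inv_le_one_of_one_le₀ hx
  have h4 : |‖y‖ - ‖x‖| ≤ ‖x - y‖ := by rw [abs_sub_comm]; exact abs_norm_sub_norm_le x y
  calc _ ≤ ‖‖x‖⁻¹ • (x - y)‖ + ‖(‖x‖⁻¹ * (‖y‖ - ‖x‖)) • (‖y‖⁻¹ • y)‖ := h1 ▸ norm_add_le _ _
    _ = ‖x‖⁻¹ * ‖x - y‖ + ‖x‖⁻¹ * |‖y‖ - ‖x‖| := by
      rw [norm_smul, norm_smul, h2, norm_inv, norm_norm, norm_mul, norm_inv, norm_norm, mul_one,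
        Real.norm_eq_abs]
    _ ≤ 1 * ‖x - y‖ + 1 * ‖x - y‖ := by gcongr
    _ = _ := by ring

theorem norm_tangentPlane_add_sq (z : Sphere2) (w : ℂ) :
    ‖(tangentPlane z w : EuclideanSpace ℝ (Fin 3)) + z‖ ^ 2 = 1 + ‖w‖ ^ 2 := by
  rw [norm_add_sq_real, real_inner_comm, tangentPlane_inner, (norm_coe_sphere2 z), ← Submodule.coe_norm,
    (tangentPlane z).norm_map]
  ring

theorem one_le_norm_tangentPlane_add (z : Sphere2) (w : ℂ) :
    1 ≤ ‖(tangentPlane z w : EuclideanSpace ℝ (Fin 3)) + z‖ := by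
  have := norm_tangentPlane_add_sq z w
  nlinarith [norm_nonneg ((tangentPlane z w : EuclideanSpace ℝ (Fin 3)) + z), sq_nonneg ‖w‖]

/-- Central projection of the tangent plane at `z` to the sphere. -/
noncomputable def centralProj (z : Sphere2) (w : ℂ) : Sphere2 :=
  ⟨‖(tangentPlane z w : EuclideanSpace ℝ (Fin 3)) + z‖⁻¹ • (tangentPlane z w + z), by
    have := one_le_norm_tangentPlane_add z w
    have h0 : ‖(tangentPlane z w : EuclideanSpace ℝ (Fin 3)) + z‖ ≠ 0 := by linarith
    exact mem_sphere_zero_iff_norm.2 (by rw [norm_smul, norm_inv, norm_norm, inv_mul_cancel₀ h0])⟩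

theorem centralProj_zero (z : Sphere2) : centralProj z 0 = z := by
  apply Subtype.ext
  simp [centralProj, (norm_coe_sphere2 z)]

theorem lipschitzWith_centralProj (z : Sphere2) : LipschitzWith 2 (centralProj z) := by
  refine LipschitzWith.of_dist_le_mul fun v w => ?_
  rw [Subtype.dist_eq, dist_eq_norm]
  refine (norm_normalize_sub_le (one_le_norm_tangentPlane_add z v)
    (one_le_norm_tangentPlane_add z w)).trans_eq ?_
  rw [add_sub_add_right_eq_sub, ← Submodule.coe_sub, ← map_sub, ← Submodule.coe_norm,
    (tangentPlane z).norm_map, dist_eq_norm]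
  rfl

theorem closedBall_subset_centralProj (z : Sphere2) {r : ℝ} (hr : r ≤ 1) :
    closedBall z r ⊆ centralProj z '' closedBall 0 (2 * r) := by
  intro y hy
  rw [mem_closedBall, Subtype.dist_eq, dist_eq_norm] at hy
  set t : ℝ := inner ℝ (z : EuclideanSpace ℝ (Fin 3)) y with ht
  have h1 : ‖(y : EuclideanSpace ℝ (Fin 3)) - z‖ ^ 2 = 2 - 2 * t := by
    rw [norm_sub_sq_real, (norm_coe_sphere2 y), (norm_coe_sphere2 z), real_inner_comm]
    ring
  have hr0 : 0 ≤ r := (norm_nonneg _).trans hy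
  have h2 : 2 - 2 * t ≤ r ^ 2 := h1 ▸ pow_le_pow_left₀ (norm_nonneg _) hy 2
  have htpos : 1 / 2 ≤ t := by nlinarith
  have hmem : t⁻¹ • (y : EuclideanSpace ℝ (Fin 3)) - z ∈ (ℝ ∙ (z : EuclideanSpace ℝ (Fin 3)))ᗮ := by
    rw [Submodule.mem_orthogonal_singleton_iff_inner_right, inner_sub_right, inner_smul_right,
      ← ht, real_inner_self_eq_norm_sq, (norm_coe_sphere2 z), inv_mul_cancel₀ (by linarith)]
    norm_num
  have hw : (tangentPlane z ((tangentPlane z).symm ⟨_, hmem⟩) : EuclideanSpace ℝ (Fin 3)) + z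
      = t⁻¹ • y := by simp
  refine ⟨(tangentPlane z).symm ⟨_, hmem⟩, ?_, ?_⟩
  · have h3 := norm_tangentPlane_add_sq z ((tangentPlane z).symm ⟨_, hmem⟩)
    rw [hw, norm_smul, (norm_coe_sphere2 y), mul_one, norm_inv, Real.norm_of_nonneg (by linarith)] at h3
    rw [mem_closedBall_zero_iff]
    refine abs_le_of_sq_le_sq' ?_ (by positivity) |>.2
    have h4 : t⁻¹ ^ 2 * t ^ 2 = 1 := by rw [← mul_pow, inv_mul_cancel₀ (by linarith), one_pow]
    have h5 : t⁻¹ ^ 2 ≤ 4 := by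
      have : 1 / 4 ≤ t ^ 2 := by nlinarith
      nlinarith [sq_nonneg t⁻¹]
    have h6 : t ≤ 1 := by nlinarith [sq_nonneg ‖(y : EuclideanSpace ℝ (Fin 3)) - z‖]
    have h7 : t⁻¹ ^ 2 - 1 = t⁻¹ ^ 2 * (1 - t ^ 2) := by rw [mul_sub, h4, mul_one]
    nlinarith [mul_le_mul h5 (show 1 - t ^ 2 ≤ r ^ 2 by nlinarith) (by nlinarith) (by norm_num)]
  · apply Subtype.ext
    simp only [centralProj, hw]
    rw [norm_smul, (norm_coe_sphere2 y), norm_inv, Real.norm_of_nonneg (by linarith : 0 ≤ t), mul_one, inv_inv,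
      smul_smul, mul_inv_cancel₀ (by linarith), one_smul]

/-- The area of a disc of radius one. -/
noncomputable def discArea : ℝ≥0∞ := (μH[2] : Measure ℂ) (closedBall 0 1)

theorem isAddHaarMeasure_hausdorff_complex : (μH[2] : Measure ℂ).IsAddHaarMeasure := by
  have := isAddHaarMeasure_hausdorffMeasure (E := ℂ)
  simpa [Complex.finrank_real_complex] using this

theorem hausdorffMeasure_complex_closedBall {r : ℝ} (hr : 0 ≤ r) :
    (μH[2] : Measure ℂ) (closedBall 0 r) = ENNReal.ofReal (r ^ 2) * discArea := by
  have := isAddHaarMeasure_hausdorff_complex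
  have := Measure.addHaar_closedBall' (μH[2] : Measure ℂ) 0 hr
  rw [this, Complex.finrank_real_complex, discArea]

theorem discArea_pos : 0 < discArea := by
  have := isAddHaarMeasure_hausdorff_complex
  exact measure_closedBall_pos _ _ one_pos

theorem discArea_lt_top : discArea < ⊤ := by
  have := isAddHaarMeasure_hausdorff_complex
  exact (isCompact_closedBall (0 : ℂ) 1).measure_lt_top

theorem sphereMeasure_closedBall_le (z : Sphere2) {r : ℝ} (hr0 : 0 ≤ r) (hr : r ≤ 1) :
    sphereMeasure (closedBall z r) ≤ ENNReal.ofReal (r ^ 2) * (16 * discArea) := by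
  calc sphereMeasure (closedBall z r)
      ≤ μH[2] (centralProj z '' closedBall 0 (2 * r)) :=
        measure_mono (closedBall_subset_centralProj z hr)
    _ ≤ (2 : NNReal) ^ (2 : ℝ) * μH[2] (closedBall (0 : ℂ) (2 * r)) :=
        (lipschitzWith_centralProj z).hausdorffMeasure_image_le (by norm_num) _
    _ = _ := by
      rw [hausdorffMeasure_complex_closedBall (by positivity), mul_pow, ENNReal.ofReal_mul (by norm_num)]
      norm_num
      ring

/-- A lower bound for the area of the central projection of a disc. -/
theorem le_sphereMeasure_centralProj (z : Sphere2) {r : ℝ} (hr0 : 0 ≤ r) (hr : r ≤ 1) :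
    ENNReal.ofReal ((r / 2) ^ 2) * discArea ≤ sphereMeasure (centralProj z '' closedBall 0 r) := by
  rw [← hausdorffMeasure_complex_closedBall (by positivity)]
  let P : Sphere2 → ℂ := fun y => (tangentPlane z).symm
    ((ℝ ∙ (z : EuclideanSpace ℝ (Fin 3)))ᗮ.orthogonalProjectionOnto y)
  have hP : LipschitzWith 1 P := by
    refine LipschitzWith.of_dist_le_mul fun x y => ?_
    simp only [P]
    rw [(tangentPlane z).symm.dist_map, dist_eq_norm, ← map_sub, Subtype.dist_eq, dist_eq_norm,
      NNReal.coe_one, one_mul]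
    exact Submodule.norm_orthogonalProjectionOnto_apply_le _ _
  have hPc : ∀ w, P (centralProj z w) = ‖(tangentPlane z w : EuclideanSpace ℝ (Fin 3)) + z‖⁻¹ • w := by
    intro w
    have h0 : (ℝ ∙ (z : EuclideanSpace ℝ (Fin 3)))ᗮ.orthogonalProjectionOnto
        (z : EuclideanSpace ℝ (Fin 3)) = 0 := by
      rw [Submodule.orthogonalProjectionOnto_eq_zero_iff]
      exact Submodule.le_orthogonal_orthogonal _ (Submodule.mem_span_singleton_self _)
    simp only [P, centralProj]
    rw [map_smul, map_add, h0, add_zero, Submodule.orthogonalProjectionOnto_mem_subspace_eq_self,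
      map_smul, LinearIsometryEquiv.symm_apply_apply]
  calc _ ≤ μH[2] (P '' (centralProj z '' closedBall 0 r)) := measure_mono ?_
    _ ≤ (1 : NNReal) ^ (2 : ℝ) * μH[2] (centralProj z '' closedBall 0 r) :=
        hP.hausdorffMeasure_image_le (by norm_num) _
    _ = _ := by simp [sphereMeasure]
  intro v hv
  rw [mem_closedBall_zero_iff] at hv
  have hv2 : ‖v‖ ^ 2 ≤ 1 / 4 := by nlinarith [norm_nonneg v]
  set s : ℝ := √(1 - ‖v‖ ^ 2) with hs
  have hs2 : s ^ 2 = 1 - ‖v‖ ^ 2 := Real.sq_sqrt (by linarith)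
  have hs0 : 1 / 2 ≤ s := Real.le_sqrt_of_sq_le (by linarith)
  have hspos : 0 < s := by linarith
  have hnw : ‖s⁻¹ • v‖ = s⁻¹ * ‖v‖ := by rw [norm_smul, norm_inv, Real.norm_of_nonneg hspos.le]
  refine ⟨_, ⟨s⁻¹ • v, ?_, rfl⟩, ?_⟩
  · rw [mem_closedBall_zero_iff, hnw, inv_mul_le_iff₀ hspos]
    nlinarith [norm_nonneg v]
  · have h3 := norm_tangentPlane_add_sq z (s⁻¹ • v)
    have h4 : ‖(tangentPlane z (s⁻¹ • v) : EuclideanSpace ℝ (Fin 3)) + z‖ = s⁻¹ := by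
      refine (sq_eq_sq₀ (norm_nonneg _) (by positivity)).1 ?_
      rw [h3, hnw]
      field_simp
      linarith
    rw [hPc, h4, inv_inv, smul_smul, mul_inv_cancel₀ hspos.ne', one_smul]

instance : IsFiniteMeasure sphereMeasure := by
  have : CompactSpace Sphere2 := isCompact_iff_compactSpace.1 (isCompact_sphere _ _)
  obtain ⟨t, -, ht⟩ := isCompact_univ.elim_nhds_subcover (fun z : Sphere2 => closedBall z 1)
    (fun z _ => closedBall_mem_nhds z one_pos)
  refine ⟨(measure_mono ht).trans_lt ((measure_biUnion_finset_le t _).trans_lt ?_)⟩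
  refine ENNReal.sum_lt_top.2 fun z _ => (sphereMeasure_closedBall_le z zero_le_one le_rfl).trans_lt ?_
  exact ENNReal.mul_lt_top ENNReal.ofReal_lt_top (ENNReal.mul_lt_top (by simp) discArea_lt_top)

/-- Quadratic area growth of balls. -/
theorem exists_sphereMeasure_closedBall_le :
    ∃ K : ℝ, 0 < K ∧ ∀ (z : Sphere2) (r : ℝ), 0 ≤ r →
      sphereMeasure (closedBall z r) ≤ ENNReal.ofReal (K * r ^ 2) := by
  refine ⟨16 * discArea.toReal + (sphereMeasure univ).toReal, ?_, fun z r hr0 => ?_⟩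
  · have := ENNReal.toReal_pos discArea_pos.ne' discArea_lt_top.ne
    positivity
  · rcases le_total r 1 with hr | hr
    · refine (sphereMeasure_closedBall_le z hr0 hr).trans ?_
      have h : (16 : ℝ≥0∞) * discArea = ENNReal.ofReal (16 * discArea.toReal) := by
        rw [ENNReal.ofReal_mul (by norm_num), ENNReal.ofReal_toReal discArea_lt_top.ne]
        norm_num
      rw [h, ← ENNReal.ofReal_mul (by positivity)]
      apply ENNReal.ofReal_le_ofReal
      nlinarith [mul_nonneg (sq_nonneg r) (sphereMeasure univ).toReal_nonneg]
    · refine (measure_mono (subset_univ _)).trans ?_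
      refine (ENNReal.ofReal_toReal (measure_ne_top sphereMeasure univ)).symm.trans_le ?_
      apply ENNReal.ofReal_le_ofReal
      have h : 1 ≤ r ^ 2 := one_le_pow₀ hr
      nlinarith [discArea.toReal_nonneg, (sphereMeasure univ).toReal_nonneg]

/-- Two points of the circle bound two arcs; the first one is the shorter arc. -/
theorem exists_circle_arcs (u₀ u₁ : sphere (0 : ℂ) 1) :
    ∃ a b : unitInterval → sphere (0 : ℂ) 1, Continuous a ∧ Continuous b ∧
      a 0 = u₀ ∧ b 0 = u₀ ∧ a 1 = u₁ ∧ b 1 = u₁ ∧ range a ∪ range b = univ ∧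
      (∀ s, dist u₀ (a s) ≤ dist u₀ u₁) ∧
      ∀ s t, dist (a s) u₀ ≤ dist (a s) (b t) ∨ dist (a s) u₁ ≤ dist (a s) (b t) := by
  have hn : ∀ u : sphere (0 : ℂ) 1, ‖(u : ℂ)‖ = 1 := fun u => mem_sphere_zero_iff_norm.1 u.2
  have hu0 : (u₀ : ℂ) ≠ 0 := fun h => by simpa [h] using hn u₀
  let σ : ℝ := if 0 ≤ Complex.arg (u₁ / u₀) then 1 else -1
  have hσ : σ = 1 ∨ σ = -1 := by
    simp only [σ]
    split_ifs <;> simp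
  have hσσ : σ * σ = 1 := by rcases hσ with h | h <;> simp [h]
  let c : ℝ → sphere (0 : ℂ) 1 := fun x => ⟨u₀ * Complex.exp (Complex.I * (σ * x : ℝ)), by
    rw [mem_sphere_zero_iff_norm, norm_mul, hn, mul_comm Complex.I, Complex.norm_exp_ofReal_mul_I,
      one_mul]⟩
  have hc : Continuous c := by fun_prop
  have hc0 : c 0 = u₀ := Subtype.ext (by simp [c])
  have hcper : ∀ x, c (x - 2 * Real.pi) = c x := by
    intro x
    apply Subtype.ext
    simp only [c]
    congr 1
    rcases hσ with h | h
    · rw [h, Complex.exp_eq_exp_iff_exists_int]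
      exact ⟨-1, by push_cast; ring⟩
    · rw [h, Complex.exp_eq_exp_iff_exists_int]
      exact ⟨1, by push_cast; ring⟩
  have hdist : ∀ x y, dist (c x) (c y) = 2 * |Real.sin ((x - y) / 2)| := by
    intro x y
    have h1 : (c x : ℂ) - c y =
        c y * (Complex.exp (Complex.I * (σ * (x - y) : ℝ)) - 1) := by
      simp only [c]
      rw [mul_sub, mul_assoc, ← Complex.exp_add, mul_one]
      congr 3
      push_cast
      ring
    rw [Subtype.dist_eq, dist_eq_norm, h1, norm_mul, hn, one_mul,
      Complex.norm_exp_I_mul_ofReal_sub_one, norm_mul, Real.norm_eq_abs, Real.norm_eq_abs, abs_two]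
    rcases hσ with h | h
    · rw [h, one_mul]
    · rw [h, neg_one_mul, neg_div, Real.sin_neg, abs_neg]
  have harg : ∀ u : sphere (0 : ℂ) 1, c (σ * Complex.arg (u / u₀)) = u := by
    intro u
    apply Subtype.ext
    have h3 := Complex.norm_mul_exp_arg_mul_I ((u : ℂ) / u₀)
    rw [norm_div, hn, hn, div_one, Complex.ofReal_one, one_mul] at h3
    simp only [c]
    rw [← mul_assoc, hσσ, one_mul, mul_comm Complex.I, h3]
    field_simp
  set φ : ℝ := σ * Complex.arg (u₁ / u₀) with hφ
  have hcφ : c φ = u₁ := harg u₁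
  have hφ0 : 0 ≤ φ := by
    simp only [hφ, σ]
    split_ifs with h <;> linarith
  have habs : ∀ u : ℂ, |σ * Complex.arg u| ≤ Real.pi := by
    intro u
    have : |σ| = 1 := by rcases hσ with h | h <;> simp [h]
    rw [abs_mul, this, one_mul]
    exact Complex.abs_arg_le_pi u
  have hφπ : φ ≤ Real.pi := (le_abs_self _).trans (habs _)
  have hπ := Real.pi_pos
  have hcov : ∀ L : ℝ, 0 ≤ L → ∀ x ∈ Icc 0 L, ∃ t : unitInterval, (t : ℝ) * L = x := by
    intro L hL x hx
    rcases hL.eq_or_lt with rfl | hL'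
    · exact ⟨0, by simpa using hx.1.antisymm hx.2⟩
    · exact ⟨⟨x / L, div_nonneg hx.1 hL, div_le_one_of_le₀ hx.2 hL⟩, div_mul_cancel₀ _ hL'.ne'⟩
  refine ⟨fun t => c (t * φ), fun t => c (-(t * (2 * Real.pi - φ))), by fun_prop, by fun_prop,
    by simp [hc0], by simp [hc0], by simp [hcφ], ?_, ?_, ?_, ?_⟩
  · simp only [Icc.coe_one, one_mul, neg_sub]
    rw [hcper, hcφ]
  · rw [eq_univ_iff_forall]
    intro u
    have h1 := abs_le.1 (habs (u / u₀))
    rw [← harg u]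
    set x := σ * Complex.arg (u / u₀)
    rcases lt_or_ge x 0 with hx | hx
    · right
      obtain ⟨t, ht⟩ := hcov (2 * Real.pi - φ) (by linarith) (-x) ⟨by linarith, by linarith⟩
      exact ⟨t, by simp [ht]⟩
    · rcases le_or_gt x φ with hxφ | hxφ
      · left
        obtain ⟨t, ht⟩ := hcov φ hφ0 x ⟨hx, hxφ⟩
        exact ⟨t, by simp [ht]⟩
      · right
        obtain ⟨t, ht⟩ := hcov (2 * Real.pi - φ) (by linarith) (2 * Real.pi - x)
          ⟨by linarith, by linarith⟩
        exact ⟨t, by simp [ht, hcper]⟩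
  · intro s
    have h1 : (s : ℝ) * φ ≤ φ := mul_le_of_le_one_left hφ0 s.2.2
    have h2 : 0 ≤ (s : ℝ) * φ := mul_nonneg s.2.1 hφ0
    rw [dist_comm, dist_comm u₀, ← hcφ, ← hc0, hdist, hdist]
    simp only [sub_zero]
    rw [abs_of_nonneg (Real.sin_nonneg_of_nonneg_of_le_pi (by linarith) (by linarith)),
      abs_of_nonneg (Real.sin_nonneg_of_nonneg_of_le_pi (by linarith) (by linarith))]
    have := Real.sin_le_sin_of_le_of_le_pi_div_two (x := s * φ / 2) (y := φ / 2) (by linarith)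
      (by linarith) (by linarith)
    linarith
  · intro s t
    have h1 : (s : ℝ) * φ ≤ φ := mul_le_of_le_one_left hφ0 s.2.2
    have h2 : 0 ≤ (s : ℝ) * φ := mul_nonneg s.2.1 hφ0
    have h3 : (t : ℝ) * (2 * Real.pi - φ) ≤ 2 * Real.pi - φ :=
      mul_le_of_le_one_left (by linarith) t.2.2
    have h4 : 0 ≤ (t : ℝ) * (2 * Real.pi - φ) := mul_nonneg t.2.1 (by linarith)
    set x := (s : ℝ) * φ
    set y := (t : ℝ) * (2 * Real.pi - φ)
    have key : ∀ v, 0 ≤ v → ∀ w, v ≤ w → w ≤ Real.pi / 2 → |Real.sin v| ≤ |Real.sin w| := by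
      intro v hv w hvw hw
      rw [abs_of_nonneg (Real.sin_nonneg_of_nonneg_of_le_pi hv (by linarith)),
        abs_of_nonneg (Real.sin_nonneg_of_nonneg_of_le_pi (by linarith) (by linarith))]
      exact Real.sin_le_sin_of_le_of_le_pi_div_two (by linarith) hw hvw
    rcases le_total (x + y) Real.pi with hxy | hxy
    · left
      rw [← hc0, hdist, hdist]
      have := key ((x - 0) / 2) (by linarith) ((x - -y) / 2) (by linarith) (by linarith)
      linarith
    · right
      rw [← hcφ, hdist, hdist]
      have := key ((φ - x) / 2) (by linarith) (Real.pi - (x - -y) / 2) (by linarith) (by linarith)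
      rw [Real.sin_pi_sub] at this
      rw [← abs_neg, ← Real.sin_neg, show -((x - φ) / 2) = (φ - x) / 2 by ring]
      linarith

theorem compactSpace_sphere2 : CompactSpace Sphere2 :=
  isCompact_iff_compactSpace.1 (isCompact_sphere _ _)

theorem locallyConnectedSpace_sphere2 : LocallyConnectedSpace Sphere2 :=
  have : Fact (Module.finrank ℝ (EuclideanSpace ℝ (Fin 3)) = 2 + 1) := ⟨by simp⟩
  ChartedSpace.locallyConnectedSpace (EuclideanSpace ℝ (Fin 2))
    (sphere (0 : EuclideanSpace ℝ (Fin 3)) 1)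

/-- The `η`-quasisymmetry inequality for a map on the unit circle. -/
def CircleQS (η : ℝ → ℝ) (f : sphere (0 : ℂ) 1 → Sphere2) : Prop :=
  ∀ u v w : sphere (0 : ℂ) 1, u ≠ w →
    dist (f u) (f v) ≤ η (dist u v / dist u w) * dist (f u) (f w)

theorem IsQSControl.nonneg {η : ℝ → ℝ} (hη : IsQSControl η) {x : ℝ} (hx : 0 ≤ x) : 0 ≤ η x := by
  rw [← hη.2.2.1]
  exact hη.2.1.monotoneOn self_mem_Ici hx hx

theorem IsQSControl.le_one {η : ℝ → ℝ} (hη : IsQSControl η) {x : ℝ} (hx : 0 ≤ x) (hx1 : x ≤ 1) :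
    η x ≤ η 1 :=
  hη.2.1.monotoneOn hx (mem_Ici.2 zero_le_one) hx1

theorem CircleQS.continuous {η : ℝ → ℝ} (hη : IsQSControl η) {f : sphere (0 : ℂ) 1 → Sphere2}
    (hf : CircleQS η f) : Continuous f := by
  rw [continuous_iff_continuousAt]
  intro u
  have hne : u ≠ -u := by
    intro h
    have h1 : (u : ℂ) = -u := congrArg Subtype.val h
    have h2 : (u : ℂ) = 0 := by linear_combination h1 / 2
    simpa [h2] using u.2
  have hlim : Tendsto (fun v => η (dist u v / dist u (-u)) * dist (f u) (f (-u))) (𝓝 u) (𝓝 0) := by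
    have h1 : Tendsto (fun v => dist u v / dist u (-u)) (𝓝 u) (𝓝[Ici 0] 0) := by
      refine tendsto_nhdsWithin_iff.2 ⟨?_, Eventually.of_forall fun v => ?_⟩
      · have : Continuous fun v => dist u v / dist u (-u) := by fun_prop
        simpa using this.tendsto u
      · exact div_nonneg dist_nonneg dist_nonneg
    have h2 := ((hη.1 0 self_mem_Ici).tendsto.comp h1).mul_const (dist (f u) (f (-u)))
    rw [hη.2.2.1, zero_mul] at h2
    exact h2
  rw [ContinuousAt, tendsto_iff_dist_tendsto_zero]
  refine squeeze_zero (fun _ => dist_nonneg) (fun v => ?_) hlim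
  rw [dist_comm]
  exact hf u v (-u) hne

theorem CircleQS.dist_le {η : ℝ → ℝ} (hη : IsQSControl η) {f : sphere (0 : ℂ) 1 → Sphere2}
    (hf : CircleQS η f) {u v w : sphere (0 : ℂ) 1} (h : dist u v ≤ dist u w) :
    dist (f u) (f v) ≤ η 1 * dist (f u) (f w) := by
  by_cases huw : u = w
  · subst huw
    rw [dist_self] at h
    rw [dist_le_zero.1 h, dist_self, mul_zero]
  · refine (hf u v w huw).trans (mul_le_mul_of_nonneg_right (hη.le_one ?_ ?_) dist_nonneg)
    · exact div_nonneg dist_nonneg dist_nonneg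
    · exact div_le_one_of_le₀ h dist_nonneg

/-- The union of the components of the complement of `C` that are disjoint from `S`. -/
def holeOf (S C : Set Sphere2) : Set Sphere2 :=
  {z | z ∉ C ∧ Disjoint (connectedComponentIn Cᶜ z) S}

theorem subset_holeOf {S C D : Set Sphere2} {z : Sphere2} (hz : z ∈ holeOf S C)
    (hD : IsPreconnected D) (hzD : z ∈ D) (hDC : Disjoint D C) : D ⊆ holeOf S C := by
  intro y hy
  refine ⟨fun h => Set.disjoint_left.1 hDC hy h, ?_⟩
  have h1 : D ⊆ connectedComponentIn Cᶜ z :=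
    hD.subset_connectedComponentIn hzD fun x hx h => Set.disjoint_left.1 hDC hx h
  rw [← connectedComponentIn_eq (h1 hy)]
  exact hz.2

theorem mem_holeOf_of_notMem {S C : Set Sphere2} (hC : IsPreconnected (S \ C)) {N z : Sphere2}
    (hN : N ∈ S \ C) (hzC : z ∉ C) (hz : z ∉ connectedComponentIn Cᶜ N) : z ∈ holeOf S C := by
  refine ⟨hzC, Set.disjoint_left.2 fun y hy hyS => hz ?_⟩
  have hyC : y ∉ C := connectedComponentIn_subset _ _ hy
  have h1 : y ∈ connectedComponentIn Cᶜ N :=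
    hC.subset_connectedComponentIn hN (fun x hx => hx.2) ⟨hyS, hyC⟩
  rw [connectedComponentIn_eq h1, ← connectedComponentIn_eq hy]
  exact mem_connectedComponentIn hzC

/-- A hole of the carpet bounded by a quasicircle contains a point far from the curve. -/
theorem exists_mem_holeOf_infDist {S C : Set Sphere2} (hC : IsPeripheralCircle S C) {η : ℝ → ℝ}
    (hη : IsQSControl η) {f : sphere (0 : ℂ) 1 → Sphere2} (hr : range f = C)
    (hf : CircleQS η f) {u₀ u₁ : sphere (0 : ℂ) 1} (hne : f u₀ ≠ f u₁) :
    ∃ z ∈ holeOf S C, dist z (f u₀) < (η 1 + 1) * dist (f u₀) (f u₁) ∧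
      dist (f u₀) (f u₁) / (8 * (η 1 + 1)) ≤ infDist z C := by
  have := compactSpace_sphere2
  have := locallyConnectedSpace_sphere2
  have hcont := hf.continuous hη
  set H := η 1 with hHdef
  have hH : 0 ≤ H := hη.nonneg zero_le_one
  set p := f u₀
  set q := f u₁
  set d := dist p q with hd
  have hd0 : 0 < d := dist_pos.2 hne
  set ε := d / (8 * (H + 1)) with hε
  have hεd : ε * (8 * (H + 1)) = d := div_mul_cancel₀ _ (by positivity)
  have hε0 : 0 < ε := by positivity
  obtain ⟨N, hNS⟩ := hC.2.2.nonempty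
  obtain ⟨e, he⟩ := exists_homeomorph_onePoint N
  by_contra hcon
  push Not at hcon
  set U := connectedComponentIn Cᶜ N with hU
  have hCc : IsClosed C := hr ▸ (isCompact_range hcont).isClosed
  have hUo : IsOpen U := hCc.isOpen_compl.connectedComponentIn
  have hUC : Disjoint U C := Set.disjoint_left.2 fun z hz => connectedComponentIn_subset _ _ hz
  obtain ⟨a, b, ha, hb, ha0, hb0, ha1, hb1, hab, haR, hsep⟩ := exists_circle_arcs u₀ u₁
  have hfa : Continuous fun t => f (a t) := hcont.comp ha
  have hfb : Continuous fun t => f (b t) := hcont.comp hb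
  let α : Set Sphere2 := range fun t => f (a t)
  let β : Set Sphere2 := range fun t => f (b t)
  have hαc : IsCompact α := isCompact_range hfa
  have hβc : IsCompact β := isCompact_range hfb
  have hCαβ : C = α ∪ β := by
    rw [← hr]
    apply Subset.antisymm
    · rintro _ ⟨u, rfl⟩
      have : u ∈ range a ∪ range b := hab ▸ mem_univ u
      rcases this with ⟨t, rfl⟩ | ⟨t, rfl⟩
      exacts [Or.inl ⟨t, rfl⟩, Or.inr ⟨t, rfl⟩]
    · rintro _ (⟨t, rfl⟩ | ⟨t, rfl⟩) <;> exact mem_range_self _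
  have hαC : α ⊆ C := hCαβ ▸ subset_union_left
  have hβC : β ⊆ C := hCαβ ▸ subset_union_right
  have hαne : α.Nonempty := range_nonempty _
  have hβne : β.Nonempty := range_nonempty _
  have hCU : C ⊆ Uᶜ := fun z hz h => Set.disjoint_left.1 hUC h hz
  let A : Set Sphere2 := {z | z ∈ Uᶜ ∧ infDist z α ≤ ε}
  let B : Set Sphere2 := {z | z ∈ Uᶜ ∧ (infDist z β ≤ ε ∨ (H + 1) * d ≤ dist z p)}
  have hA : IsClosed A := hUo.isClosed_compl.inter
    (isClosed_le (continuous_infDist_pt α) continuous_const)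
  have hB : IsClosed B := hUo.isClosed_compl.inter
    ((isClosed_le (continuous_infDist_pt β) continuous_const).union
      (isClosed_le continuous_const (continuous_id.dist continuous_const)))
  have hAB : (A ∪ B)ᶜ = U := by
    rw [compl_eq_comm]
    apply Subset.antisymm
    · intro z hz
      by_cases hfar : (H + 1) * d ≤ dist z p
      · exact Or.inr ⟨hz, Or.inr hfar⟩
      have hnear : infDist z C < ε := by
        by_cases hzC : z ∈ C
        · rwa [infDist_zero_of_mem hzC]
        · exact hcon z (mem_holeOf_of_notMem hC.2.2.isPreconnected hNS hzC hz) (not_le.1 hfar)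
      obtain ⟨y, hy, hzy⟩ := (infDist_lt_iff (hαne.mono hαC)).1 hnear
      rw [hCαβ] at hy
      rcases hy with hy | hy
      · exact Or.inl ⟨hz, (infDist_le_dist_of_mem hy).trans hzy.le⟩
      · exact Or.inr ⟨hz, Or.inl ((infDist_le_dist_of_mem hy).trans hzy.le)⟩
    · rintro z (hz | hz) <;> exact hz.1
  have hnotN : ∀ z ∈ C, e z ≠ OnePoint.infty := fun z hz h =>
    hNS.2 (e.injective (h.trans he.symm) ▸ hz)
  refine not_isPreconnected_compl_union e (W := ball p (d / 2)) hA hB hfa hfb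
    (fun t => ⟨hCU (hαC ⟨t, rfl⟩), ?_⟩) (fun t => ⟨hCU (hβC ⟨t, rfl⟩), Or.inl ?_⟩)
    (by rw [ha0, hb0]) (by rw [ha1, hb1]) (fun t => hnotN _ (hαC ⟨t, rfl⟩))
    (fun t => hnotN _ (hβC ⟨t, rfl⟩)) ?_ ?_ ?_ (hAB ▸ isPreconnected_connectedComponentIn)
  · exact (infDist_zero_of_mem (s := α) ⟨t, rfl⟩).trans_le hε0.le
  · exact (infDist_zero_of_mem (s := β) ⟨t, rfl⟩).trans_le hε0.le
  · rw [ha0]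
    exact mem_ball_self (by positivity)
  · rw [ha1]
    intro h
    have := mem_closedBall.1 (closure_ball_subset_closedBall h)
    rw [dist_comm] at this
    linarith
  · rw [Set.disjoint_left]
    rintro z hz ⟨⟨-, hzα⟩, -, hzβ⟩
    have hzp : dist z p = d / 2 := mem_sphere.1 (frontier_ball_subset_sphere hz)
    have hdq : d ≤ dist z p + dist z q := dist_triangle_left _ _ _
    have hmin : ∀ s : Set Sphere2, IsCompact s → s.Nonempty → infDist z s ≤ ε →
        ∃ y ∈ s, dist z y ≤ ε := by
      intro s hs hsne hle
      obtain ⟨y, hy, hyd⟩ := hs.exists_infDist_eq_dist hsne z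
      exact ⟨y, hy, hyd ▸ hle⟩
    obtain ⟨_, ⟨s, rfl⟩, hs⟩ := hmin α hαc hαne hzα
    simp only at hs
    rcases hzβ with hzβ | hzβ
    · obtain ⟨_, ⟨t, rfl⟩, ht⟩ := hmin β hβc hβne hzβ
      simp only at ht
      have hst : dist (f (a s)) (f (b t)) ≤ 2 * ε := by
        have := dist_triangle_left (f (a s)) (f (b t)) z
        linarith
      rcases hsep s t with h | h
      · have h1 := hf.dist_le hη h
        have h2 := dist_triangle z (f (a s)) p
        nlinarith
      · have h1 := hf.dist_le hη h
        have h2 := dist_triangle z (f (a s)) q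
        nlinarith
    · have h1 := hf.dist_le hη (haR s)
      have h2 := dist_triangle_right z p (f (a s))
      nlinarith

/-- A quasicircle leaves room for a definite disc on the side away from the carpet. -/
theorem exists_cap_subset_holeOf {S C : Set Sphere2} (hC : IsPeripheralCircle S C) {η : ℝ → ℝ}
    (hη : IsQSControl η) {f : sphere (0 : ℂ) 1 → Sphere2} (hr : range f = C)
    (hf : CircleQS η f) {u₀ u₁ : sphere (0 : ℂ) 1} (hne : f u₀ ≠ f u₁) :
    ∃ z : Sphere2, centralProj z '' closedBall 0 (dist (f u₀) (f u₁) / (32 * (η 1 + 1))) ⊆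
      holeOf S C ∩ ball (f u₀) ((η 1 + 2) * dist (f u₀) (f u₁)) := by
  obtain ⟨z, hz, hz1, hz2⟩ := exists_mem_holeOf_infDist hC hη hr hf hne
  have hH : 0 ≤ η 1 := hη.nonneg zero_le_one
  set d := dist (f u₀) (f u₁)
  have hd0 : 0 < d := dist_pos.2 hne
  set ρ := d / (32 * (η 1 + 1)) with hρ
  have hρ0 : 0 < ρ := by positivity
  have hρd : ρ * (32 * (η 1 + 1)) = d := div_mul_cancel₀ _ (by positivity)
  have hsub : centralProj z '' closedBall 0 ρ ⊆ closedBall z (2 * ρ) := by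
    rintro _ ⟨w, hw, rfl⟩
    have h1 := (lipschitzWith_centralProj z).dist_le_mul w 0
    rw [centralProj_zero] at h1
    rw [mem_closedBall]
    refine h1.trans ?_
    rw [mem_closedBall] at hw
    exact mul_le_mul_of_nonneg_left hw zero_le_two
  refine ⟨z, subset_inter (subset_holeOf hz ?_ ?_ ?_) fun y hy => ?_⟩
  · exact (convex_closedBall _ _).isPreconnected.image _
      (lipschitzWith_centralProj z).continuous.continuousOn
  · exact ⟨0, mem_closedBall_self hρ0.le, centralProj_zero z⟩
  · rw [Set.disjoint_left]
    intro y hy hyC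
    have h1 := infDist_le_dist_of_mem (x := z) hyC
    have h2 := mem_closedBall'.1 (hsub hy)
    have h3 : d / (8 * (η 1 + 1)) = 4 * ρ := by rw [hρ]; field_simp; norm_num
    linarith
  · have h2 := mem_closedBall.1 (hsub hy)
    have h3 := dist_triangle y z (f u₀)
    rw [mem_ball]
    nlinarith

theorem frontier_connectedComponentIn_subset {X : Type*} [TopologicalSpace X]
    [LocallyConnectedSpace X] {C : Set X} (hC : IsClosed C) (z : X) :
    frontier (connectedComponentIn Cᶜ z) ⊆ C := by
  intro y hy
  by_contra hyC
  have ho : ∀ x, IsOpen (connectedComponentIn Cᶜ x) := fun x => hC.isOpen_compl.connectedComponentIn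
  obtain ⟨x, hx, hxz⟩ := mem_closure_iff.1 (frontier_subset_closure hy) _ (ho y)
    (mem_connectedComponentIn hyC)
  have h : connectedComponentIn Cᶜ z = connectedComponentIn Cᶜ y :=
    (connectedComponentIn_eq hxz).trans (connectedComponentIn_eq hx).symm
  rw [(ho z).frontier_eq] at hy
  exact hy.2 (h ▸ mem_connectedComponentIn hyC)

theorem IsPeripheralCircle.isClosed {S C : Set Sphere2} (hC : IsPeripheralCircle S C) :
    IsClosed C := by
  obtain ⟨h⟩ := hC.2.1
  have : CompactSpace C := h.symm.compactSpace
  exact (isCompact_iff_compactSpace.2 this).isClosed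

theorem connectedComponentIn_eq_of_mem_holeOf {S C₁ C₂ : Set Sphere2} (h₁ : C₁ ⊆ S) (h₂ : C₂ ⊆ S)
    {z : Sphere2} (hz₁ : z ∈ holeOf S C₁) (hz₂ : z ∈ holeOf S C₂) :
    connectedComponentIn C₁ᶜ z = connectedComponentIn C₂ᶜ z := by
  apply Subset.antisymm <;>
    refine isPreconnected_connectedComponentIn.subset_connectedComponentIn
      (mem_connectedComponentIn ?_) fun x hx hxC => ?_
  exacts [hz₁.1, Set.disjoint_left.1 hz₁.2 hx (h₂ hxC), hz₂.1,
    Set.disjoint_left.1 hz₂.2 hx (h₁ hxC)]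

theorem IsPeripheralCircle.subset_of_mem_holeOf {S C₁ C₂ : Set Sphere2}
    (h₁ : IsPeripheralCircle S C₁) (h₂ : IsPeripheralCircle S C₂)
    {z : Sphere2} (hz₁ : z ∈ holeOf S C₁) (hz₂ : z ∈ holeOf S C₂) : C₁ ⊆ C₂ := by
  have := locallyConnectedSpace_sphere2
  intro c hc₁
  by_contra hc₂
  obtain ⟨g⟩ := h₁.2.1
  let f : sphere (0 : ℂ) 1 → Sphere2 := fun u => g.symm u
  have hf : Continuous f := by fun_prop
  have hinj : Function.Injective f := Subtype.val_injective.comp g.symm.injective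
  have hr : range f = C₁ := (g.symm.surjective.range_comp Subtype.val).trans Subtype.range_coe
  have hfc : f (g ⟨c, hc₁⟩) = c := by simp [f]
  obtain ⟨y, hyS, hyC⟩ := h₁.2.2.nonempty
  obtain ⟨e, he⟩ := exists_homeomorph_onePoint c
  have hfr : frontier (connectedComponentIn C₁ᶜ z) ⊆ C₁ :=
    frontier_connectedComponentIn_subset h₁.isClosed z
  have hfr₂ : frontier (connectedComponentIn C₁ᶜ z) ⊆ C₂ := by
    rw [connectedComponentIn_eq_of_mem_holeOf h₁.1 h₂.1 hz₁ hz₂]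
    exact frontier_connectedComponentIn_subset h₂.isClosed z
  refine not_frontier_subset_jordan_diff e hf hinj (u₀ := g ⟨c, hc₁⟩)
    (W := connectedComponentIn C₁ᶜ z) (x := z) (y := y) ?_ (mem_connectedComponentIn hz₁.1)
    (hr ▸ hz₁.1) ?_ (hr ▸ hyC) ?_ ?_
  · rw [hr, hfc]
    exact fun x hx => ⟨hfr hx, fun h => hc₂ (h ▸ hfr₂ hx)⟩
  · rw [closure_eq_self_union_frontier]
    rintro (h | h)
    · exact Set.disjoint_left.1 hz₁.2 h hyS
    · exact hyC (hfr h)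
  · exact fun h => hz₁.1 (e.injective (h.trans he.symm) ▸ hc₁)
  · exact fun h => hyC (e.injective (h.trans he.symm) ▸ hc₁)

theorem disjoint_holeOf_holeOf {S C₁ C₂ : Set Sphere2} (h₁ : IsPeripheralCircle S C₁)
    (h₂ : IsPeripheralCircle S C₂) (hne : C₁ ≠ C₂) : Disjoint (holeOf S C₁) (holeOf S C₂) :=
  Set.disjoint_left.2 fun _ hz₁ hz₂ => hne
    ((h₁.subset_of_mem_holeOf h₂ hz₁ hz₂).antisymm (h₂.subset_of_mem_holeOf h₁ hz₂ hz₁))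

theorem dist_sphere2_le (x y : Sphere2) : dist x y ≤ 2 := by
  rw [Subtype.dist_eq, dist_eq_norm]
  refine (norm_sub_le _ _).trans_eq ?_
  rw [norm_coe_sphere2, norm_coe_sphere2]
  norm_num

/-- The constant in the lower area bound for the holes. -/
noncomputable def holeConst (η : ℝ → ℝ) : ℝ := (1 / (64 * (η 1 + 1))) ^ 2 * discArea.toReal

theorem holeConst_pos {η : ℝ → ℝ} (hη : IsQSControl η) : 0 < holeConst η := by
  have h1 := hη.nonneg zero_le_one
  have h2 := ENNReal.toReal_pos discArea_pos.ne' discArea_lt_top.ne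
  unfold holeConst
  positivity

theorem exists_fat_subset_holeOf {S C : Set Sphere2} (hC : IsPeripheralCircle S C) {η : ℝ → ℝ}
    (hη : IsQSControl η) {f : sphere (0 : ℂ) 1 → Sphere2} (hr : range f = C)
    (hf : CircleQS η f) {u₀ u₁ : sphere (0 : ℂ) 1} (hne : f u₀ ≠ f u₁) :
    ∃ E : Set Sphere2, MeasurableSet E ∧ E ⊆ holeOf S C ∧
      E ⊆ ball (f u₀) ((η 1 + 2) * dist (f u₀) (f u₁)) ∧
      ENNReal.ofReal (holeConst η * dist (f u₀) (f u₁) ^ 2) ≤ sphereMeasure E := by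
  obtain ⟨z, hz⟩ := exists_cap_subset_holeOf hC hη hr hf hne
  have hH : 0 ≤ η 1 := hη.nonneg zero_le_one
  refine ⟨_, ?_, hz.trans inter_subset_left, hz.trans inter_subset_right,
    le_trans (le_of_eq ?_) (le_sphereMeasure_centralProj z ?_ ?_)⟩
  · exact ((isCompact_closedBall _ _).image
      (lipschitzWith_centralProj z).continuous).isClosed.measurableSet
  · rw [← ENNReal.ofReal_toReal discArea_lt_top.ne, ← ENNReal.ofReal_mul (by positivity), holeConst]
    congr 1
    field_simp
    norm_num
    ring
  · positivity
  · rw [div_le_one (by positivity)]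
    linarith [dist_sphere2_le (f u₀) (f u₁)]

/-- Peripheral circles that are uniform quasicircles are comparable to pairwise disjoint fat sets. -/
theorem exists_packing {S : Set Sphere2} (hq : UniformQuasicircles {C | IsPeripheralCircle S C}) :
    ∃ (l c : ℝ) (x : {C // IsPeripheralCircle S C} → Sphere2)
      (r : {C // IsPeripheralCircle S C} → ℝ) (E : {C // IsPeripheralCircle S C} → Set Sphere2),
      2 ≤ l ∧ 0 < c ∧ (∀ i, 0 < r i) ∧ (∀ i, i.1 ⊆ closedBall (x i) (r i)) ∧
      (∀ i, MeasurableSet (E i)) ∧ (∀ i, E i ⊆ ball (x i) (l * r i)) ∧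
      (∀ i, ENNReal.ofReal (c * r i ^ 2) ≤ sphereMeasure (E i)) ∧
      Pairwise (Function.onFun Disjoint E) := by
  obtain ⟨η, hη, hf⟩ := hq
  have key : ∀ i : {C // IsPeripheralCircle S C}, ∃ (x : Sphere2) (r : ℝ) (E : Set Sphere2),
      0 < r ∧ i.1 ⊆ closedBall x r ∧ MeasurableSet E ∧ E ⊆ holeOf S i.1 ∧
      E ⊆ ball x ((η 1 + 2) * r) ∧ ENNReal.ofReal (holeConst η * r ^ 2) ≤ sphereMeasure E := by
    intro i
    obtain ⟨f, hr, hinj, hqs⟩ := hf i.1 i.2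
    have hcont : Continuous f := CircleQS.continuous hη hqs
    let u₀ : sphere (0 : ℂ) 1 := ⟨1, by simp⟩
    obtain ⟨u₁, -, hu₁⟩ := isCompact_univ.exists_isMaxOn ⟨u₀, mem_univ _⟩
      (f := fun u => dist (f u₀) (f u)) (by fun_prop)
    have hmax : ∀ u, dist (f u₀) (f u) ≤ dist (f u₀) (f u₁) := fun u => hu₁ (mem_univ u)
    have hne : f u₀ ≠ f u₁ := by
      intro h
      have h1 := hmax ⟨-1, by simp⟩
      rw [h, dist_self, ← h, dist_le_zero] at h1
      have h2 := congrArg Subtype.val (hinj h1)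
      norm_num [u₀, Complex.ext_iff] at h2
    obtain ⟨E, hE⟩ := exists_fat_subset_holeOf i.2 hη hr hqs hne
    refine ⟨f u₀, dist (f u₀) (f u₁), E, dist_pos.2 hne, ?_, hE⟩
    rw [← hr]
    rintro _ ⟨u, rfl⟩
    rw [mem_closedBall']
    exact hmax u
  choose x r E hr hC hE hh hb hm using key
  refine ⟨η 1 + 2, holeConst η, x, r, E, by linarith [hη.nonneg zero_le_one], holeConst_pos hη, hr,
    hC, hE, hb, hm, fun i j hij => ?_⟩
  exact (disjoint_holeOf_holeOf i.2 j.2 fun h => hij (Subtype.ext h)).mono (hh i) (hh j)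

/-- Only finitely many peripheral circles pass through a given point. -/
theorem finite_peripheral_through {S : Set Sphere2}
    (hq : UniformQuasicircles {C | IsPeripheralCircle S C}) (p : Sphere2) :
    {C | IsPeripheralCircle S C ∧ p ∈ C}.Finite := by
  obtain ⟨η, hη, hf⟩ := hq
  obtain ⟨K, hK, hball⟩ := exists_sphereMeasure_closedBall_le
  have hc := holeConst_pos hη
  have hH := hη.nonneg zero_le_one
  by_contra hinf
  obtain ⟨n, hn⟩ := exists_nat_gt (K * (η 1 + 2) ^ 2 / holeConst η)
  obtain ⟨t, ht, htn⟩ := Set.Infinite.exists_subset_card_eq hinf n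
  have key : ∀ C ∈ t, ∃ m : ℝ, 0 < m ∧ ∀ d, 0 < d → d ≤ m → ∃ E : Set Sphere2, MeasurableSet E ∧
      E ⊆ holeOf S C ∧ E ⊆ ball p ((η 1 + 2) * d) ∧
      ENNReal.ofReal (holeConst η * d ^ 2) ≤ sphereMeasure E := by
    intro C hCt
    obtain ⟨hC, hpC⟩ := ht hCt
    obtain ⟨f, hr, hinj, hqs⟩ := hf C hC
    have hcont : Continuous f := CircleQS.continuous hη hqs
    obtain ⟨u₀, rfl⟩ : p ∈ range f := hr ▸ hpC
    have hne : -u₀ ≠ u₀ := by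
      intro h
      have h1 : -(u₀ : ℂ) = u₀ := congrArg Subtype.val h
      have h2 : (u₀ : ℂ) = 0 := by linear_combination -h1 / 2
      simpa [h2] using u₀.2
    refine ⟨dist (f u₀) (f (-u₀)), dist_pos.2 fun h => hne (hinj h).symm, fun d hd0 hd => ?_⟩
    have hconn : IsPreconnected (univ : Set (sphere (0 : ℂ) 1)) := by
      have : PreconnectedSpace (sphere (0 : ℂ) 1) := by
        rw [← isPreconnected_iff_preconnectedSpace]
        exact isPreconnected_sphere (by simp [Complex.rank_real_complex]) 0 1
      exact isPreconnected_univ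
    obtain ⟨u₁, -, hu₁⟩ := hconn.intermediate_value (mem_univ u₀) (mem_univ (-u₀))
      (f := fun u => dist (f u₀) (f u)) (by fun_prop) ⟨by simpa using hd0.le, hd⟩
    simp only at hu₁
    have := exists_fat_subset_holeOf hC hη hr hqs (u₀ := u₀) (u₁ := u₁) (dist_pos.1 (by rwa [hu₁]))
    rwa [hu₁] at this
  choose! m hm hE using key
  obtain ⟨d, hd0, hd⟩ : ∃ d : ℝ, 0 < d ∧ ∀ C ∈ t, d ≤ m C := by
    rcases t.eq_empty_or_nonempty with rfl | hne
    · exact ⟨1, one_pos, by simp⟩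
    · obtain ⟨C₀, hC₀, hmin⟩ := t.exists_min_image m hne
      exact ⟨m C₀, hm C₀ hC₀, hmin⟩
  choose! E hEm hEh hEb hEl using fun C (hC : C ∈ t) => hE C hC d hd0 (hd C hC)
  have hsum : ∑ C ∈ t, sphereMeasure (E C) ≤ sphereMeasure (closedBall p ((η 1 + 2) * d)) := by
    rw [← measure_biUnion_finset ?_ hEm]
    · exact measure_mono (iUnion₂_subset fun C hC => (hEb C hC).trans ball_subset_closedBall)
    · intro C hC C' hC' hne
      exact (disjoint_holeOf_holeOf (ht hC).1 (ht hC').1 hne).mono (hEh C hC) (hEh C' hC')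
  have hlow : (n : ℝ≥0∞) * ENNReal.ofReal (holeConst η * d ^ 2) ≤ ∑ C ∈ t, sphereMeasure (E C) := by
    rw [← htn, ← nsmul_eq_mul]
    exact Finset.card_nsmul_le_sum _ _ _ hEl
  have hall := (hlow.trans hsum).trans (hball p _ (by positivity))
  rw [← ENNReal.ofReal_natCast, ← ENNReal.ofReal_mul (by positivity),
    ENNReal.ofReal_le_ofReal_iff (by positivity)] at hall
  rw [div_lt_iff₀ hc] at hn
  nlinarith [mul_lt_mul_of_pos_right hn (pow_pos hd0 2)]

theorem lintegral_sum_indicator_mul_sum_indicator {α ι : Type*} [MeasurableSpace α] (μ : Measure α)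
    (t : Finset ι) (a b : ι → ℝ≥0∞) {A B : ι → Set α} (hA : ∀ i, MeasurableSet (A i))
    (hB : ∀ i, MeasurableSet (B i)) :
    ∫⁻ y, (∑ i ∈ t, (A i).indicator (fun _ => a i) y) *
      (∑ j ∈ t, (B j).indicator (fun _ => b j) y) ∂μ =
      ∑ i ∈ t, ∑ j ∈ t, a i * b j * μ (A i ∩ B j) := by
  simp_rw [Finset.sum_mul_sum]
  rw [lintegral_finsetSum]
  · refine Finset.sum_congr rfl fun i _ => ?_
    rw [lintegral_finsetSum]
    · refine Finset.sum_congr rfl fun j _ => ?_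
      rw [← lintegral_indicator_const ((hA i).inter (hB j))]
      refine lintegral_congr fun y => ?_
      by_cases h1 : y ∈ A i <;> by_cases h2 : y ∈ B j <;> simp [h1, h2]
    · exact fun j _ => (measurable_const.indicator (hA i)).mul (measurable_const.indicator (hB j))
  · exact fun i _ => Finset.measurable_sum _ fun j _ =>
      (measurable_const.indicator (hA i)).mul (measurable_const.indicator (hB j))

theorem sq_lintegral_mul_le {α : Type*} [MeasurableSpace α] (μ : Measure α) {f g : α → ℝ≥0∞}
    (hf : Measurable f) (hg : Measurable g) :
    (∫⁻ y, f y * g y ∂μ) ^ 2 ≤ (∫⁻ y, f y ^ 2 ∂μ) * ∫⁻ y, g y ^ 2 ∂μ := by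
  have h := ENNReal.lintegral_mul_le_Lp_mul_Lq μ Real.HolderConjugate.two_two hf.aemeasurable
    hg.aemeasurable
  simp only [Pi.mul_apply, ENNReal.rpow_two] at h
  have hsq : ∀ x : ℝ≥0∞, (x ^ (1 / (2 : ℝ))) ^ 2 = x := by
    intro x
    rw [← ENNReal.rpow_two, ← ENNReal.rpow_mul]
    norm_num
  calc _ ≤ _ := pow_le_pow_left₀ zero_le h 2
    _ = _ := by rw [mul_pow, hsq, hsq]

theorem le_of_forall_sq_le {x : ℕ → ℝ≥0∞} {M A : ℝ≥0∞} (hM : M ≠ ⊤) (hx : ∀ k, x k ≤ M)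
    (h : ∀ k, x k ^ 2 ≤ A * x (k + 1)) : x 0 ≤ A := by
  have hs : (⨆ k, x k) ≠ ⊤ := ne_top_of_le_ne_top hM (iSup_le hx)
  have h1 : (⨆ k, x k) ^ 2 ≤ A * ⨆ k, x k := by
    rw [ENNReal.iSup_pow_of_ne_zero two_ne_zero]
    exact iSup_le fun k => (h k).trans (mul_le_mul_right (le_iSup x (k + 1)) A)
  by_cases h0 : (⨆ k, x k) = 0
  · exact (le_iSup x 0).trans (h0 ▸ zero_le)
  · rw [sq] at h1
    exact (le_iSup x 0).trans ((ENNReal.mul_le_mul_iff_left h0 hs).1 h1)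

/-- Bojarski's lemma for finite families: enlarging pairwise disjoint fat sets to balls does not
increase the `L²` norm of a step function by more than a constant factor. -/
theorem lintegral_sum_ball_sq_le {X ι : Type*} [MetricSpace X] [MeasurableSpace X] [BorelSpace X]
    (μ : Measure X) [IsFiniteMeasure μ] {K l c : ℝ} (hK : 0 < K) (hl : 1 ≤ l) (hc : 0 < c)
    (hball : ∀ (z : X) (r : ℝ), 0 ≤ r → μ (closedBall z r) ≤ ENNReal.ofReal (K * r ^ 2))
    {x : ι → X} {r : ι → ℝ} {E : ι → Set X} (hr : ∀ i, 0 < r i) (hE : ∀ i, MeasurableSet (E i))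
    (hEb : ∀ i, E i ⊆ ball (x i) (l * r i))
    (hEm : ∀ i, ENNReal.ofReal (c * r i ^ 2) ≤ μ (E i)) (hd : Pairwise (Function.onFun Disjoint E))
    (t : Finset ι) {a : ι → ℝ≥0∞} (ha : ∀ i, a i ≠ ⊤) :
    ∫⁻ y, (∑ i ∈ t, (ball (x i) (l * r i)).indicator (fun _ => a i) y) ^ 2 ∂μ ≤
      81 * (2 * ENNReal.ofReal (K * l ^ 2 / c)) ^ 2 *
        ∑ i ∈ t, a i ^ 2 * ENNReal.ofReal (K * (l * r i) ^ 2) := by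
  have hl0 : 0 < l := one_pos.trans_le hl
  set D : ℝ≥0∞ := ENNReal.ofReal (K * l ^ 2 / c) with hD
  let F : ℕ → X → ℝ≥0∞ := fun k y =>
    ∑ i ∈ t, (ball (x i) (l * 3 ^ k * r i)).indicator (fun _ => a i) y
  let g : X → ℝ≥0∞ := fun y => ∑ i ∈ t, (E i).indicator (fun _ => a i) y
  have hFm : ∀ k, Measurable (F k) := fun k => Finset.measurable_sum _ fun i _ =>
    measurable_const.indicator measurableSet_ball
  have hgm : Measurable g := Finset.measurable_sum _ fun i _ => measurable_const.indicator (hE i)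
  have hpair : ∀ (k : ℕ) (i j : ι), r j ≤ r i →
      μ (ball (x i) (l * 3 ^ k * r i) ∩ ball (x j) (l * 3 ^ k * r j)) ≤
        D * 9 ^ k * μ (ball (x i) (l * 3 ^ (k + 1) * r i) ∩ E j) := by
    intro k i j hij
    rcases (ball (x i) (l * 3 ^ k * r i) ∩ ball (x j) (l * 3 ^ k * r j)).eq_empty_or_nonempty
      with hem | ⟨y, hyi, hyj⟩
    · simp [hem]
    have hsub : E j ⊆ ball (x i) (l * 3 ^ (k + 1) * r i) := by
      intro z hz
      have h1 := mem_ball.1 (hEb j hz)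
      have h2 := mem_ball.1 hyi
      have h3 := mem_ball'.1 hyj
      have h4 := dist_triangle4 z (x j) y (x i)
      have h5 : (1 : ℝ) ≤ 3 ^ k := one_le_pow₀ (by norm_num)
      have h6 : l * r j ≤ l * 3 ^ k * r i := by
        have := mul_le_mul_of_nonneg_left (mul_le_mul h5 hij (hr j).le (by positivity)) hl0.le
        linarith
      have h7 : l * 3 ^ k * r j ≤ l * 3 ^ k * r i := by gcongr
      rw [mem_ball, pow_succ]
      linarith
    rw [inter_eq_right.2 hsub]
    calc _ ≤ μ (closedBall (x j) (l * 3 ^ k * r j)) :=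
          measure_mono (inter_subset_right.trans ball_subset_closedBall)
      _ ≤ ENNReal.ofReal (K * (l * 3 ^ k * r j) ^ 2) := hball _ _ (by have := hr j; positivity)
      _ = D * 9 ^ k * ENNReal.ofReal (c * r j ^ 2) := by
        have h9 : (9 : ℝ≥0∞) ^ k = ENNReal.ofReal (9 ^ k) := by
          rw [ENNReal.ofReal_pow (by norm_num)]
          norm_num
        rw [hD, h9, ← ENNReal.ofReal_mul (by positivity), ← ENNReal.ofReal_mul (by positivity)]
        congr 1
        rw [show (9 : ℝ) ^ k = (3 ^ k) ^ 2 by rw [← pow_mul, mul_comm, pow_mul]; norm_num]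
        field_simp
      _ ≤ _ := by gcongr; exact hEm j
  have hY : ∀ k, ∫⁻ y, F k y ^ 2 ∂μ ≤ 2 * D * 9 ^ k * ∫⁻ y, F (k + 1) y * g y ∂μ := by
    intro k
    simp_rw [sq]
    simp only [F, g]
    rw [lintegral_sum_indicator_mul_sum_indicator μ t a a (fun _ => measurableSet_ball)
      (fun _ => measurableSet_ball), lintegral_sum_indicator_mul_sum_indicator μ t a a
      (fun _ => measurableSet_ball) hE]
    have hswap : 2 * D * 9 ^ k * ∑ i ∈ t, ∑ j ∈ t, a i * a j *
        μ (ball (x i) (l * 3 ^ (k + 1) * r i) ∩ E j) = ∑ i ∈ t, ∑ j ∈ t, a i * a j * (D * 9 ^ k *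
          (μ (ball (x i) (l * 3 ^ (k + 1) * r i) ∩ E j) +
            μ (ball (x j) (l * 3 ^ (k + 1) * r j) ∩ E i))) := by
      simp only [mul_add, Finset.sum_add_distrib]
      rw [Finset.sum_comm (f := fun i j => a i * a j * (D * 9 ^ k *
        μ (ball (x j) (l * 3 ^ (k + 1) * r j) ∩ E i)))]
      rw [mul_assoc 2, two_mul, add_mul]
      congr 1
      all_goals
        rw [Finset.mul_sum]
        refine Finset.sum_congr rfl fun i _ => ?_
        rw [Finset.mul_sum]
        exact Finset.sum_congr rfl fun j _ => by ring
    rw [hswap]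
    refine Finset.sum_le_sum fun i _ => Finset.sum_le_sum fun j _ => mul_le_mul_right ?_ _
    rcases le_total (r j) (r i) with h | h
    · exact (hpair k i j h).trans (mul_le_mul_right le_self_add _)
    · rw [inter_comm]
      exact (hpair k j i h).trans (mul_le_mul_right le_add_self _)
  have hg : ∫⁻ y, g y ^ 2 ∂μ ≤ ∑ i ∈ t, a i ^ 2 * ENNReal.ofReal (K * (l * r i) ^ 2) := by
    simp_rw [sq (g _)]
    simp only [g]
    rw [lintegral_sum_indicator_mul_sum_indicator μ t a a hE hE]
    refine Finset.sum_le_sum fun i hi => ?_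
    rw [Finset.sum_eq_single_of_mem i hi]
    · rw [inter_self, ← sq]
      refine mul_le_mul_right ((measure_mono ((hEb i).trans ball_subset_closedBall)).trans
        (hball _ _ ?_)) _
      have := hr i
      positivity
    · intro j _ hji
      rw [(hd hji.symm).inter_eq, measure_empty, mul_zero]
  set Q := ∑ i ∈ t, a i ^ 2 * ENNReal.ofReal (K * (l * r i) ^ 2) with hQ
  have h81 : ∀ k : ℕ, (81 : ℝ≥0∞) ^ k ≠ 0 ∧ (81 : ℝ≥0∞) ^ k ≠ ⊤ := fun k =>
    ⟨pow_ne_zero _ (by norm_num), ENNReal.pow_ne_top (by norm_num)⟩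
  have key := le_of_forall_sq_le (x := fun k => (∫⁻ y, F k y ^ 2 ∂μ) / 81 ^ k)
    (M := (∑ i ∈ t, a i) ^ 2 * μ univ) (A := 81 * (2 * D) ^ 2 * Q) ?_ ?_ ?_
  · simpa [F] using key
  · exact ENNReal.mul_ne_top (ENNReal.pow_ne_top (ENNReal.sum_ne_top.2 fun i _ => ha i))
      (measure_ne_top _ _)
  · intro k
    refine ENNReal.div_le_of_le_mul ?_
    calc ∫⁻ y, F k y ^ 2 ∂μ ≤ ∫⁻ _, (∑ i ∈ t, a i) ^ 2 ∂μ := by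
          refine lintegral_mono fun y => pow_le_pow_left₀ zero_le ?_ 2
          exact Finset.sum_le_sum fun i _ => indicator_le_self _ (fun _ => a i) y
      _ = (∑ i ∈ t, a i) ^ 2 * μ univ * 1 := by rw [lintegral_const, mul_one]
      _ ≤ _ := by
        gcongr
        exact one_le_pow₀ (by norm_num)
  · intro k
    have h1 : (∫⁻ y, F k y ^ 2 ∂μ) ^ 2 ≤ (2 * D) ^ 2 * 81 ^ k * ((∫⁻ y, F (k + 1) y ^ 2 ∂μ) * Q) := by
      calc _ ≤ (2 * D * 9 ^ k * ∫⁻ y, F (k + 1) y * g y ∂μ) ^ 2 := pow_le_pow_left₀ zero_le (hY k) 2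
        _ = (2 * D) ^ 2 * 81 ^ k * (∫⁻ y, F (k + 1) y * g y ∂μ) ^ 2 := by
          rw [mul_pow, mul_pow (2 * D), ← pow_mul, mul_comm k, pow_mul]
          norm_num
        _ ≤ _ := by
          refine mul_le_mul_right ((sq_lintegral_mul_le μ (hFm _) hgm).trans ?_) _
          exact mul_le_mul_right hg _
    have h2 : 81 * (2 * D) ^ 2 * Q * ((∫⁻ y, F (k + 1) y ^ 2 ∂μ) / 81 ^ (k + 1)) =
        ((2 * D) ^ 2 * 81 ^ k * ((∫⁻ y, F (k + 1) y ^ 2 ∂μ) * Q)) / (81 ^ k) ^ 2 := by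
      set Y := ∫⁻ y, F (k + 1) y ^ 2 ∂μ
      rw [ENNReal.eq_div_iff (pow_ne_zero _ (h81 k).1) (ENNReal.pow_ne_top (h81 k).2), sq (81 ^ k)]
      calc _ = (81 ^ (k + 1) * (Y / 81 ^ (k + 1))) * ((2 * D) ^ 2 * 81 ^ k * Q) := by ring
        _ = _ := by rw [ENNReal.mul_div_cancel (h81 _).1 (h81 _).2]; ring
    rw [h2, div_eq_mul_inv, mul_pow, ← ENNReal.inv_pow, ← div_eq_mul_inv]
    exact ENNReal.div_le_div_right h1 _

/-- The parameter at which a curve on `[a,b]` has first travelled the length `u`. -/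
noncomputable def arcTime (f : ℝ → Sphere2) (a b u : ℝ) : ℝ :=
  sInf {t | t ∈ Icc a b ∧ ENNReal.ofReal u ≤ eVariationOn f (Icc a t)}

section ArcTime

variable {f : ℝ → Sphere2} {a b : ℝ}

theorem eVariationOn_Icc_add (f : ℝ → Sphere2) {a p q : ℝ} (hap : a ≤ p) (hpq : p ≤ q) :
    eVariationOn f (Icc a p) + eVariationOn f (Icc p q) = eVariationOn f (Icc a q) := by
  have := eVariationOn.Icc_add_Icc f (s := univ) hap hpq (mem_univ p)
  simpa using this

theorem arcTime_mem (hab : a ≤ b) {u : ℝ}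
    (hu : ENNReal.ofReal u ≤ eVariationOn f (Icc a b)) : arcTime f a b u ∈ Icc a b := by
  have hb : b ∈ {t | t ∈ Icc a b ∧ ENNReal.ofReal u ≤ eVariationOn f (Icc a t)} :=
    ⟨right_mem_Icc.2 hab, hu⟩
  exact ⟨le_csInf ⟨b, hb⟩ fun t ht => ht.1.1, csInf_le ⟨a, fun t ht => ht.1.1⟩ hb⟩

theorem dist_arcTime_le (hab : a ≤ b) (hf : ContinuousOn f (Icc a b))
    {u v : ℝ} (hu : 0 ≤ u) (huv : u ≤ v)
    (hv : ENNReal.ofReal v ≤ eVariationOn f (Icc a b)) :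
    dist (f (arcTime f a b u)) (f (arcTime f a b v)) ≤ v - u := by
  have hu' : ENNReal.ofReal u ≤ eVariationOn f (Icc a b) :=
    (ENNReal.ofReal_le_ofReal huv).trans hv
  have hmu := arcTime_mem hab hu'
  have hmv := arcTime_mem hab hv
  have hle : arcTime f a b u ≤ arcTime f a b v :=
    csInf_le_csInf ⟨a, fun t ht => ht.1.1⟩ ⟨b, right_mem_Icc.2 hab, hv⟩
      fun t ht => ⟨ht.1, (ENNReal.ofReal_le_ofReal huv).trans ht.2⟩
  rcases hle.eq_or_lt with heq | hlt
  · rw [heq, dist_self]; linarith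
  set α := arcTime f a b u with hα
  set β := arcTime f a b v with hβ
  have key : ∀ p ∈ Ioo α β, ∀ q ∈ Ioo p β, dist (f p) (f q) ≤ v - u := by
    intro p hp q hq
    have hap : a ≤ p := hmu.1.trans hp.1.le
    have hqb : q ≤ b := hq.2.le.trans hmv.2
    obtain ⟨t, ht, htp⟩ := exists_lt_of_csInf_lt
      (s := {t | t ∈ Icc a b ∧ ENNReal.ofReal u ≤ eVariationOn f (Icc a t)})
      ⟨b, right_mem_Icc.2 hab, hu'⟩ hp.1
    have h1 : ENNReal.ofReal u ≤ eVariationOn f (Icc a p) :=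
      ht.2.trans (eVariationOn.mono f (Icc_subset_Icc_right htp.le))
    have h2 : eVariationOn f (Icc a q) ≤ ENNReal.ofReal v := by
      by_contra hcon
      have : β ≤ q := csInf_le ⟨a, fun t ht => ht.1.1⟩
        ⟨⟨hap.trans hq.1.le, hqb⟩, (not_le.1 hcon).le⟩
      exact absurd hq.2 (not_lt.2 this)
    have h3 := eVariationOn_Icc_add f hap hq.1.le
    have h4 : edist (f p) (f q) ≤ eVariationOn f (Icc p q) :=
      eVariationOn.edist_le f (left_mem_Icc.2 hq.1.le) (right_mem_Icc.2 hq.1.le)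
    have h5 : ENNReal.ofReal u + edist (f p) (f q) ≤ ENNReal.ofReal v := by
      refine (add_le_add h1 h4).trans ?_
      rw [h3]; exact h2
    rw [edist_dist, ← ENNReal.ofReal_add hu dist_nonneg,
      ENNReal.ofReal_le_ofReal_iff (hu.trans huv)] at h5
    linarith
  have key2 : ∀ p ∈ Ioo α β, dist (f p) (f β) ≤ v - u := by
    intro p hp
    have hc : Tendsto f (𝓝[<] β) (𝓝 (f β)) :=
      ((hf β hmv).mono_of_mem_nhdsWithin
        (mem_of_superset (Ioo_mem_nhdsLT hlt) fun z hz =>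
          ⟨hmu.1.trans hz.1.le, hz.2.le.trans hmv.2⟩))
    refine le_of_tendsto (tendsto_const_nhds.dist hc) ?_
    filter_upwards [Ioo_mem_nhdsLT hp.2] with q hq using key p hp q hq
  have hc : Tendsto f (𝓝[>] α) (𝓝 (f α)) :=
    ((hf α hmu).mono_of_mem_nhdsWithin
      (mem_of_superset (Ioo_mem_nhdsGT hlt) fun z hz =>
        ⟨hmu.1.trans hz.1.le, hz.2.le.trans hmv.2⟩))
  refine le_of_tendsto (hc.dist tendsto_const_nhds) ?_
  filter_upwards [Ioo_mem_nhdsGT hlt] with q hq using key2 q hq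

theorem apply_arcTime_variation (hf : ContinuousOn f (Icc a b))
    (hfin : eVariationOn f (Icc a b) ≠ ⊤) {t₀ : ℝ} (ht₀ : t₀ ∈ Icc a b) :
    f (arcTime f a b (eVariationOn f (Icc a t₀)).toReal) = f t₀ := by
  have hft : eVariationOn f (Icc a t₀) ≠ ⊤ :=
    ne_top_of_le_ne_top hfin (eVariationOn.mono f (Icc_subset_Icc_right ht₀.2))
  set A := {t | t ∈ Icc a b ∧
    ENNReal.ofReal (eVariationOn f (Icc a t₀)).toReal ≤ eVariationOn f (Icc a t)} with hA
  have h0A : t₀ ∈ A := ⟨ht₀, by rw [ENNReal.ofReal_toReal hft]⟩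
  have hbdd : BddBelow A := ⟨a, fun t ht => ht.1.1⟩
  have hmem : sInf A ∈ Icc a b :=
    ⟨le_csInf ⟨t₀, h0A⟩ fun t ht => ht.1.1, (csInf_le hbdd h0A).trans ht₀.2⟩
  have hconst : ∀ t ∈ A, t ≤ t₀ → f t = f t₀ := by
    intro t ht htt
    have h1 := ht.2
    rw [ENNReal.ofReal_toReal hft, ← eVariationOn_Icc_add f ht.1.1 htt] at h1
    have hfint : eVariationOn f (Icc a t) ≠ ⊤ :=
      ne_top_of_le_ne_top hfin (eVariationOn.mono f (Icc_subset_Icc_right ht.1.2))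
    have h2 : eVariationOn f (Icc t t₀) = 0 := by
      by_contra hne
      exact absurd h1 (not_le.2 (ENNReal.lt_add_right hfint hne))
    have h4 : edist (f t) (f t₀) ≤ eVariationOn f (Icc t t₀) :=
      eVariationOn.edist_le f (left_mem_Icc.2 htt) (right_mem_Icc.2 htt)
    rw [h2] at h4
    exact edist_eq_zero.1 (le_antisymm h4 zero_le)
  obtain ⟨w, hw, hwlim, hwA⟩ := exists_seq_tendsto_sInf ⟨t₀, h0A⟩ hbdd
  show f (sInf A) = f t₀
  by_cases hmin : sInf A = t₀
  · rw [hmin]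
  have hlt : sInf A < t₀ := lt_of_le_of_ne (csInf_le hbdd h0A) hmin
  have h1 : Tendsto (fun n => f (w n)) atTop (𝓝 (f (sInf A))) :=
    (hf _ hmem).tendsto.comp
      (tendsto_nhdsWithin_iff.2 ⟨hwlim, Eventually.of_forall fun n => (hwA n).1⟩)
  have h2 : Tendsto (fun n => f (w n)) atTop (𝓝 (f t₀)) := by
    refine tendsto_const_nhds.congr' ?_
    filter_upwards [hwlim.eventually (gt_mem_nhds hlt)] with n hn
    exact (hconst _ (hwA n) hn.le).symm
  exact tendsto_nhds_unique h1 h2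

theorem mul_le_arcIntegralOn_indicator (hab : a ≤ b) (hf : ContinuousOn f (Icc a b))
    (hfin : eVariationOn f (Icc a b) ≠ ⊤) {x : Sphere2} {r R : ℝ} (hR : 2 * r ≤ R)
    {t₀ t₁ : ℝ} (ht₀ : t₀ ∈ Icc a b) (ht₁ : t₁ ∈ Icc a b) (h₀ : f t₀ ∈ closedBall x r)
    (h₁ : f t₁ ∉ ball x (2 * r)) (c : ℝ≥0∞) :
    c * ENNReal.ofReal r ≤ arcIntegralOn ((ball x R).indicator fun _ => c) f a b := by
  have hfi : ∀ t ∈ Icc a b, eVariationOn f (Icc a t) ≠ ⊤ := fun t ht =>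
    ne_top_of_le_ne_top hfin (eVariationOn.mono f (Icc_subset_Icc_right ht.2))
  have hsL : ∀ t ∈ Icc a b,
      (eVariationOn f (Icc a t)).toReal ≤ (eVariationOn f (Icc a b)).toReal := fun t ht =>
    ENNReal.toReal_mono hfin (eVariationOn.mono f (Icc_subset_Icc_right ht.2))
  have hLip : ∀ u v, 0 ≤ u → u ≤ v → v ≤ (eVariationOn f (Icc a b)).toReal →
      dist (f (arcTime f a b u)) (f (arcTime f a b v)) ≤ v - u := fun u v hu huv hv =>
    dist_arcTime_le hab hf hu huv (ENNReal.ofReal_le_of_le_toReal hv)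
  have e₀ := apply_arcTime_variation hf hfin ht₀
  have e₁ := apply_arcTime_variation hf hfin ht₁
  have hs₀ := hsL t₀ ht₀
  have hs₁ := hsL t₁ ht₁
  have hd : r ≤ dist (f t₀) (f t₁) := by
    rw [mem_closedBall] at h₀
    rw [mem_ball, not_lt] at h₁
    have := dist_triangle (f t₁) (f t₀) x
    rw [dist_comm (f t₁) (f t₀)] at this
    linarith
  set u₀ := (eVariationOn f (Icc a t₀)).toReal with hu₀
  set u₁ := (eVariationOn f (Icc a t₁)).toReal with hu₁
  have hu₀0 : 0 ≤ u₀ := ENNReal.toReal_nonneg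
  have hu₁0 : 0 ≤ u₁ := ENNReal.toReal_nonneg
  have main : ∀ J : Set ℝ, MeasurableSet J →
      J ⊆ Ico 0 (eVariationOn f (Icc a b)).toReal → volume J = ENNReal.ofReal r →
      (∀ u ∈ J, dist (f (arcTime f a b u)) (f t₀) < r) →
      c * ENNReal.ofReal r ≤ arcIntegralOn ((ball x R).indicator fun _ => c) f a b := by
    intro J hJm hJ hvol hdist
    calc c * ENNReal.ofReal r = ∫⁻ _ in J, c := by rw [setLIntegral_const, hvol]
      _ ≤ ∫⁻ u in J, (ball x R).indicator (fun _ => c) (f (arcTime f a b u)) := by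
          refine setLIntegral_mono' hJm fun u hu => ?_
          rw [indicator_of_mem]
          have := dist_triangle (f (arcTime f a b u)) (f t₀) x
          have h3 := hdist u hu
          rw [mem_closedBall] at h₀
          rw [mem_ball]; linarith
      _ ≤ _ := lintegral_mono_set hJ
  rcases le_total u₀ u₁ with h | h
  · have hd' : r ≤ u₁ - u₀ := by
      have := hLip u₀ u₁ hu₀0 h hs₁
      rw [e₀, e₁] at this; linarith
    refine main (Ioo u₀ (u₀ + r)) measurableSet_Ioo
      (fun u hu => ⟨hu₀0.trans hu.1.le, by have := hu.2; linarith⟩) (by simp) fun u hu => ?_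
    have := hLip u₀ u hu₀0 hu.1.le (by have := hu.2; linarith)
    rw [e₀, dist_comm] at this
    have := hu.2; linarith
  · have hd' : r ≤ u₀ - u₁ := by
      have := hLip u₁ u₀ hu₁0 h hs₀
      rw [e₀, e₁, dist_comm] at this; linarith
    refine main (Ioo (u₀ - r) u₀) measurableSet_Ioo
      (fun u hu => ⟨by have := hu.1; linarith, by have := hu.2; linarith⟩) (by simp)
      fun u hu => ?_
    have := hLip u u₀ (by have := hu.1; linarith) hu.2.le hs₀
    rw [e₀] at this
    have := hu.1; linarith

end ArcTime

theorem arcIntegralOn_mono {ρ ρ' : Sphere2 → ℝ≥0∞} (h : ρ ≤ ρ') (f : ℝ → Sphere2) (a b : ℝ) :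
    arcIntegralOn ρ f a b ≤ arcIntegralOn ρ' f a b :=
  lintegral_mono fun _ => h _

theorem SpherePath.lineIntegral_mono {ρ ρ' : Sphere2 → ℝ≥0∞} (h : ρ ≤ ρ') (γ : SpherePath) :
    γ.lineIntegral ρ ≤ γ.lineIntegral ρ' :=
  iSup_mono fun a => iSup_mono fun b => iSup_mono fun _ => arcIntegralOn_mono h _ a b

theorem SpherePath.mul_lineIntegral_le (c : ℝ≥0∞) (ρ : Sphere2 → ℝ≥0∞) (γ : SpherePath) :
    c * γ.lineIntegral ρ ≤ γ.lineIntegral fun y => c * ρ y := by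
  simp_rw [SpherePath.lineIntegral, ENNReal.mul_iSup]
  exact iSup_mono fun a => iSup_mono fun b => iSup_mono fun _ => lintegral_const_mul_le _ _

theorem sum_arcIntegralOn_le {ι : Type*} (t : Finset ι) (ρ : ι → Sphere2 → ℝ≥0∞)
    (f : ℝ → Sphere2) (a b : ℝ) :
    ∑ i ∈ t, arcIntegralOn (ρ i) f a b ≤ arcIntegralOn (fun y => ∑ i ∈ t, ρ i y) f a b := by
  classical
  induction t using Finset.induction_on with
  | empty => simp
  | insert i t hi ih =>
    rw [Finset.sum_insert hi]
    simp_rw [Finset.sum_insert hi]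
    exact (add_le_add le_rfl ih).trans (le_lintegral_add _ _)

theorem SpherePath.exists_Icc (γ : SpherePath) {t : Finset ℝ} (ht : (t : Set ℝ) ⊆ γ.I) :
    ∃ a b : ℝ, a ≤ b ∧ Icc a b ⊆ γ.I ∧ (t : Set ℝ) ⊆ Icc a b := by
  have hord : γ.I.OrdConnected := by
    obtain ⟨a, b, -, h | h | h | h⟩ := γ.hI <;> rw [h] <;> infer_instance
  have hne : γ.I.Nonempty := by
    obtain ⟨a, b, hab, h | h | h | h⟩ := γ.hI <;> rw [h]
    exacts [nonempty_Icc.2 hab.le, nonempty_Ico.2 hab, nonempty_Ioc.2 hab, nonempty_Ioo.2 hab]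
  rcases t.eq_empty_or_nonempty with rfl | htn
  · obtain ⟨z, hz⟩ := hne
    exact ⟨z, z, le_rfl, by simpa using hz, by simp⟩
  · exact ⟨t.min' htn, t.max' htn, t.min'_le_max' htn,
      hord.out (ht (t.min'_mem htn)) (ht (t.max'_mem htn)),
      fun z hz => ⟨t.min'_le z hz, t.le_max' z hz⟩⟩

theorem SpherePath.sum_mul_le_lineIntegral {ι : Type*} {γ : SpherePath} (hγ : γ.LocRectifiable)
    (t : Finset ι) {x : ι → Sphere2} {r R : ι → ℝ} (hR : ∀ i, 2 * r i ≤ R i)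
    (h₀ : ∀ i ∈ t, (γ.image ∩ closedBall (x i) (r i)).Nonempty)
    (h₁ : ∀ i ∈ t, ¬ γ.image ⊆ ball (x i) (2 * r i)) (c : ι → ℝ≥0∞) :
    ∑ i ∈ t, c i * ENNReal.ofReal (r i) ≤
      γ.lineIntegral fun y => ∑ i ∈ t, (ball (x i) (R i)).indicator (fun _ => c i) y := by
  classical
  have h₀' : ∀ i : t, ∃ s ∈ γ.I, γ.toFun s ∈ closedBall (x i) (r i) := by
    rintro ⟨i, hi⟩
    obtain ⟨_, ⟨s, hs, rfl⟩, hsb⟩ := h₀ i hi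
    exact ⟨s, hs, hsb⟩
  have h₁' : ∀ i : t, ∃ s ∈ γ.I, γ.toFun s ∉ ball (x i) (2 * r i) := by
    rintro ⟨i, hi⟩
    obtain ⟨_, ⟨s, hs, rfl⟩, hsb⟩ := not_subset.1 (h₁ i hi)
    exact ⟨s, hs, hsb⟩
  choose p hpI hp using h₀'
  choose q hqI hq using h₁'
  obtain ⟨a, b, hab, habI, hsub⟩ := γ.exists_Icc
    (t := Finset.univ.image p ∪ Finset.univ.image q) (by
      intro z hz
      simp only [Finset.coe_union, Finset.coe_image, mem_union, mem_image] at hz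
      obtain ⟨i, -, rfl⟩ | ⟨i, -, rfl⟩ := hz
      exacts [hpI i, hqI i])
  have hpab : ∀ i, p i ∈ Icc a b := fun i => hsub (by simp)
  have hqab : ∀ i, q i ∈ Icc a b := fun i => hsub (by simp)
  calc ∑ i ∈ t, c i * ENNReal.ofReal (r i)
      ≤ ∑ i ∈ t, arcIntegralOn ((ball (x i) (R i)).indicator fun _ => c i) γ.toFun a b :=
        Finset.sum_le_sum fun i hi => mul_le_arcIntegralOn_indicator hab (γ.cont.mono habI)
          (hγ a b habI).ne (hR i) (hpab ⟨i, hi⟩) (hqab ⟨i, hi⟩) (hp ⟨i, hi⟩) (hq ⟨i, hi⟩) _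
    _ ≤ _ := sum_arcIntegralOn_le t _ _ a b
    _ ≤ _ := le_iSup₂_of_le a b (le_iSup_of_le (f := fun _ => _) habI le_rfl)

theorem ENNReal.iSup_sq {ι : Sort*} (g : ι → ℝ≥0∞) : (⨆ i, g i) ^ 2 = ⨆ i, g i ^ 2 :=
  (show Monotone fun z : ℝ≥0∞ => z ^ 2 from pow_left_mono 2).map_iSup_of_continuousAt
    (ENNReal.continuous_pow 2).continuousAt (by simp)

theorem lintegral_tsum_ball_sq_le {X ι : Type*} [MetricSpace X] [MeasurableSpace X]
    [BorelSpace X] [Countable ι] (μ : Measure X)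
    [IsFiniteMeasure μ] {K l c : ℝ} (hK : 0 < K) (hl : 1 ≤ l) (hc : 0 < c)
    (hball : ∀ (z : X) (r : ℝ), 0 ≤ r → μ (closedBall z r) ≤ ENNReal.ofReal (K * r ^ 2))
    {x : ι → X} {r : ι → ℝ} {E : ι → Set X} (hr : ∀ i, 0 < r i)
    (hE : ∀ i, MeasurableSet (E i)) (hEb : ∀ i, E i ⊆ ball (x i) (l * r i))
    (hEm : ∀ i, ENNReal.ofReal (c * r i ^ 2) ≤ μ (E i))
    (hd : Pairwise (Function.onFun Disjoint E)) {a : ι → ℝ≥0∞} (ha : ∀ i, a i ≠ ⊤) :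
    ∫⁻ y, (∑' i, (ball (x i) (l * r i)).indicator (fun _ => a i) y) ^ 2 ∂μ ≤
      81 * (2 * ENNReal.ofReal (K * l ^ 2 / c)) ^ 2 *
        ∑' i, a i ^ 2 * ENNReal.ofReal (K * (l * r i) ^ 2) := by
  have hsq : ∀ y, (∑' i, (ball (x i) (l * r i)).indicator (fun _ => a i) y) ^ 2 =
      ⨆ t : Finset ι, (∑ i ∈ t, (ball (x i) (l * r i)).indicator (fun _ => a i) y) ^ 2 := by
    intro y
    rw [ENNReal.tsum_eq_iSup_sum, ENNReal.iSup_sq]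
  simp_rw [hsq]
  rw [lintegral_iSup_directed]
  · refine iSup_le fun t => (lintegral_sum_ball_sq_le μ hK hl hc hball hr hE hEb hEm hd t ha).trans ?_
    gcongr
    exact ENNReal.sum_le_tsum t
  · intro t
    refine Measurable.aemeasurable ((Finset.measurable_sum t fun i _ => ?_).pow_const 2)
    exact measurable_const.indicator measurableSet_ball
  · classical
    intro s t
    refine ⟨s ∪ t, fun y => ?_, fun y => ?_⟩
    all_goals
      refine pow_le_pow_left₀ (zero_le) (Finset.sum_le_sum_of_subset ?_) 2
    exacts [Finset.subset_union_left, Finset.subset_union_right]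

theorem conformalModulus_le {Γ : Set SpherePath} {ρ : Sphere2 → ℝ≥0∞} (hρ : Measurable ρ)
    (h : ∀ γ ∈ Γ, γ.LocRectifiable → 1 ≤ γ.lineIntegral ρ) :
    conformalModulus Γ ≤ ∫⁻ y, ρ y ^ 2 ∂sphereMeasure :=
  iInf_le_of_le ρ (iInf₂_le_of_le hρ h le_rfl)

theorem conformalModulus_eq_zero_of_lineIntegral_eq_top {Γ : Set SpherePath}
    {ρ : Sphere2 → ℝ≥0∞} (hρ : Measurable ρ) (hfin : ∫⁻ y, ρ y ^ 2 ∂sphereMeasure ≠ ⊤)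
    (h : ∀ γ ∈ Γ, γ.LocRectifiable → γ.lineIntegral ρ = ⊤) : conformalModulus Γ = 0 := by
  have hb : ∀ c : ℝ≥0∞, c ≠ 0 → c ≠ ⊤ →
      conformalModulus Γ ≤ c ^ 2 * ∫⁻ y, ρ y ^ 2 ∂sphereMeasure := by
    intro c hc hct
    have hm : Measurable fun y => c * ρ y := hρ.const_mul c
    have hadm : ∀ γ ∈ Γ, γ.LocRectifiable → 1 ≤ γ.lineIntegral fun y => c * ρ y := by
      intro γ hγ hγr
      refine le_trans ?_ (γ.mul_lineIntegral_le c ρ)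
      rw [h γ hγ hγr, ENNReal.mul_top hc]
      exact le_top
    refine (conformalModulus_le hm hadm).trans ?_
    simp_rw [mul_pow]
    rw [lintegral_const_mul _ (hρ.pow_const 2)]
  have hlim : Tendsto (fun n : ℕ => ((n : ℝ≥0∞)⁻¹) ^ 2 * ∫⁻ y, ρ y ^ 2 ∂sphereMeasure) atTop
      (𝓝 0) := by
    have h1 : Tendsto (fun n : ℕ => ((n : ℝ≥0∞)⁻¹) ^ 2) atTop (𝓝 0) := by
      simpa [Function.comp_def] using
        ((ENNReal.continuous_pow 2).tendsto 0).comp ENNReal.tendsto_inv_nat_nhds_zero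
    simpa using ENNReal.Tendsto.mul_const h1 (Or.inr hfin)
  refine le_antisymm (ge_of_tendsto hlim ?_) zero_le
  filter_upwards [eventually_gt_atTop 0] with n hn
  exact hb _ (by simp) (by simp [hn.ne'])

theorem conformalModulus_mono {Γ Γ' : Set SpherePath} (h : Γ ⊆ Γ') :
    conformalModulus Γ ≤ conformalModulus Γ' :=
  iInf_mono fun _ => iInf_mono fun _ => le_iInf fun hadm =>
    iInf_le_of_le (fun γ hγ => hadm γ (h hγ)) le_rfl

theorem conformalModulus_iUnion_eq_zero {Γ : ℕ → Set SpherePath}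
    (h : ∀ n, conformalModulus (Γ n) = 0) : conformalModulus (⋃ n, Γ n) = 0 := by
  refine le_antisymm (ENNReal.le_of_forall_pos_le_add fun ε hε _ => ?_) zero_le
  obtain ⟨ε', hε'pos, hε'⟩ := ENNReal.exists_pos_sum_of_countable'
    (ENNReal.coe_pos.2 hε).ne' ℕ
  have hex : ∀ n, ∃ ρ : Sphere2 → ℝ≥0∞, Measurable ρ ∧
      (∀ γ ∈ Γ n, γ.LocRectifiable → 1 ≤ γ.lineIntegral ρ) ∧
      ∫⁻ y, ρ y ^ 2 ∂sphereMeasure < ε' n := by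
    intro n
    have := (h n).trans_lt (hε'pos n)
    simp only [conformalModulus, iInf_lt_iff] at this
    obtain ⟨ρ, hm, hadm, hlt⟩ := this
    exact ⟨ρ, hm, hadm, hlt⟩
  choose ρ hm hadm hlt using hex
  have hsup : Measurable fun y => ⨆ n, ρ n y := Measurable.iSup hm
  have hsadm : ∀ γ ∈ ⋃ n, Γ n, γ.LocRectifiable →
      1 ≤ γ.lineIntegral fun y => ⨆ n, ρ n y := by
    intro γ hγ hγr
    obtain ⟨n, hn⟩ := mem_iUnion.1 hγ
    exact (hadm n γ hn hγr).trans
      (γ.lineIntegral_mono fun y => le_iSup (fun m => ρ m y) n)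
  refine (conformalModulus_le hsup hsadm).trans ?_
  rw [zero_add]
  calc ∫⁻ y, (⨆ n, ρ n y) ^ 2 ∂sphereMeasure
      ≤ ∫⁻ y, ∑' n, ρ n y ^ 2 ∂sphereMeasure := by
        refine lintegral_mono fun y => ?_
        simp only
        rw [ENNReal.iSup_sq]
        exact iSup_le fun n => ENNReal.le_tsum n
    _ = ∑' n, ∫⁻ y, ρ n y ^ 2 ∂sphereMeasure :=
        lintegral_tsum fun n => ((hm n).pow_const 2).aemeasurable
    _ ≤ ∑' n, ε' n := ENNReal.tsum_le_tsum fun n => (hlt n).le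
    _ ≤ ε := hε'.le

/-- A square summable weight on the peripheral circles has finite total mass along all paths
outside a family of modulus zero. -/
theorem conformalModulus_exceptional_eq_zero {S : Set Sphere2}
    (hq : UniformQuasicircles {C | IsPeripheralCircle S C})
    {h : {C // IsPeripheralCircle S C} → ℝ≥0∞} (hh : ∑' i, h i ^ 2 ≠ ⊤) :
    conformalModulus {γ | ∑' i : {i : {C // IsPeripheralCircle S C} |
      (γ.image ∩ i.1).Nonempty}, h i = ⊤} = 0 := by
  classical
  obtain ⟨l, c, x, r, E, hl, hc, hr, hC, hE, hEb, hEm, hd⟩ := exists_packing hq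
  obtain ⟨K, hK, hball⟩ := exists_sphereMeasure_closedBall_le
  have hEpos : ∀ i, 0 < sphereMeasure (E i) := fun i =>
    lt_of_lt_of_le (ENNReal.ofReal_pos.2 (mul_pos hc (pow_pos (hr i) 2))) (hEm i)
  have hcount : Countable {C // IsPeripheralCircle S C} := by
    have := Measure.countable_meas_pos_of_disjoint_iUnion (μ := sphereMeasure) hE hd
    rw [show {i | 0 < sphereMeasure (E i)} = univ from eq_univ_of_forall hEpos] at this
    exact countable_univ_iff.1 this
  have hlarge : ∀ δ : ℝ, 0 < δ → {i | δ ≤ r i}.Finite := by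
    intro δ hδ
    refine (Measure.finite_const_le_meas_of_disjoint_iUnion sphereMeasure
      (ε := ENNReal.ofReal (c * δ ^ 2)) (ENNReal.ofReal_pos.2 (by positivity)) hE hd
      (measure_ne_top _ _)).subset fun i hi => ?_
    refine le_trans (ENNReal.ofReal_le_ofReal ?_) (hEm i)
    have : δ ≤ r i := hi
    gcongr
  have hht : ∀ i, h i ≠ ⊤ := fun i hi => by
    refine ENNReal.ne_top_of_tsum_ne_top hh i ?_
    simp [hi]
  have hr0 : ∀ i, ENNReal.ofReal (r i) ≠ 0 := fun i => (ENNReal.ofReal_pos.2 (hr i)).ne'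
  set ρ : Sphere2 → ℝ≥0∞ := fun y =>
    ∑' i, (ball (x i) (l * r i)).indicator (fun _ => h i / ENNReal.ofReal (r i)) y with hρ
  refine conformalModulus_eq_zero_of_lineIntegral_eq_top (ρ := ρ)
    (Measurable.tsum fun i => measurable_const.indicator measurableSet_ball) ?_ ?_
  · refine ne_top_of_le_ne_top ?_ (lintegral_tsum_ball_sq_le sphereMeasure hK (by linarith) hc
      hball hr hE hEb hEm hd fun i => (ENNReal.div_lt_top (hht i) (hr0 i)).ne)
    refine ENNReal.mul_ne_top (ENNReal.mul_ne_top (by simp) (by finiteness)) ?_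
    have : ∀ i, (h i / ENNReal.ofReal (r i)) ^ 2 * ENNReal.ofReal (K * (l * r i) ^ 2) =
        ENNReal.ofReal (K * l ^ 2) * h i ^ 2 := by
      intro i
      rw [mul_pow, ← mul_assoc, ENNReal.ofReal_mul (by positivity),
        ENNReal.ofReal_pow (hr i).le, mul_comm (ENNReal.ofReal (K * l ^ 2)), ← mul_assoc,
        ← mul_pow, ENNReal.div_mul_cancel (hr0 i) ENNReal.ofReal_ne_top, mul_comm]
    simp_rw [this]
    rw [ENNReal.tsum_mul_left]
    exact ENNReal.mul_ne_top ENNReal.ofReal_ne_top hh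
  · intro γ hγ hγr
    set M : Set {C // IsPeripheralCircle S C} := {i | (γ.image ∩ i.1).Nonempty} with hM
    set B : Set {C // IsPeripheralCircle S C} :=
      {i | (γ.image ∩ i.1).Nonempty ∧ γ.image ⊆ ball (x i) (2 * r i)} with hB
    have hBfin : B.Finite := by
      by_cases hsub : γ.image.Subsingleton
      · rcases γ.image.eq_empty_or_nonempty with he | ⟨p, hp⟩
        · convert finite_empty
          ext i; simp [hB, he]
        · refine ((finite_peripheral_through hq p).preimage
            (f := (Subtype.val : {C // IsPeripheralCircle S C} → Set Sphere2))
            Subtype.val_injective.injOn).subset ?_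
          rintro i ⟨⟨z, hz, hzC⟩, -⟩
          exact ⟨i.2, hsub hz hp ▸ hzC⟩
      · obtain ⟨p, hp, q, hq', hpq⟩ := not_subsingleton_iff.1 hsub
        refine (hlarge (dist p q / 4) (by have := dist_pos.2 hpq; linarith)).subset ?_
        rintro i ⟨-, hi⟩
        have h1 := mem_ball.1 (hi hp)
        have h2 := mem_ball.1 (hi hq')
        have := dist_triangle_right p q (x i)
        show dist p q / 4 ≤ r i
        linarith
    have hgood : ∑' i : ↥(M \ B), h i = ⊤ := by
      by_contra hne
      have hle : ∑' i : M, h i ≤ ∑' i : ↥(M \ B), h i + ∑' i : B, h i := by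
        refine (ENNReal.tsum_mono_subtype h ?_).trans (ENNReal.tsum_union_le h _ _)
        rw [sdiff_union_self]; exact subset_union_left
      have hBt : ∑' i : B, h i ≠ ⊤ := by
        have := hBfin.fintype
        rw [tsum_fintype]
        exact ENNReal.sum_ne_top.2 fun i _ => hht i
      exact absurd (hγ : ∑' i : M, h i = ⊤)
        (ne_top_of_le_ne_top (ENNReal.add_ne_top.2 ⟨hne, hBt⟩) hle)
    rw [eq_top_iff, ← hgood, ENNReal.tsum_eq_iSup_sum]
    refine iSup_le fun t => ?_
    have hsum := SpherePath.sum_mul_le_lineIntegral hγr t (x := fun i : ↥(M \ B) => x i)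
      (r := fun i => r i) (R := fun i => l * r i)
      (fun i => by have := hr i; gcongr)
      (fun i _ => i.2.1.mono (inter_subset_inter_right _ (hC i)))
      (fun i _ hsub => i.2.2 ⟨i.2.1, hsub⟩) (fun i => h i / ENNReal.ofReal (r i))
    refine le_trans (Finset.sum_le_sum fun i _ => ?_) (hsum.trans (γ.lineIntegral_mono fun y => ?_))
    · rw [ENNReal.div_mul_cancel (hr0 i) ENNReal.ofReal_ne_top]
    · refine (ENNReal.sum_le_tsum t).trans ?_
      exact ENNReal.tsum_comp_le_tsum_of_injective Subtype.val_injective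
        (fun i => (ball (x i) (l * r i)).indicator (fun _ => h i / ENNReal.ofReal (r i)) y)

theorem conformalModulus_union_eq_zero {Γ₁ Γ₂ : Set SpherePath} (h₁ : conformalModulus Γ₁ = 0)
    (h₂ : conformalModulus Γ₂ = 0) : conformalModulus (Γ₁ ∪ Γ₂) = 0 := by
  refine le_antisymm ?_ zero_le
  rw [← conformalModulus_iUnion_eq_zero (Γ := fun n => if n = 0 then Γ₁ else Γ₂)
    (fun n => by by_cases hn : n = 0 <;> simp [hn, h₁, h₂])]
  exact conformalModulus_mono (union_subset (subset_iUnion_of_subset 0 (by simp))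
    (subset_iUnion_of_subset 1 (by simp)))

theorem pathMassSum_eq_tsum (S : Set Sphere2) (ρ : Set Sphere2 → ℝ≥0∞) (γ : SpherePath) :
    pathMassSum S ρ γ =
      ∑' i : {i : {C // IsPeripheralCircle S C} | (γ.image ∩ i.1).Nonempty}, ρ i.1.1 :=
  ((Equiv.subtypeSubtypeEquivSubtypeInter (IsPeripheralCircle S)
    fun C => (γ.image ∩ C).Nonempty).tsum_eq fun C => ρ C.1).symm

theorem conformalModulus_pathMassSum_eq_top {S : Set Sphere2}
    (hq : UniformQuasicircles {C | IsPeripheralCircle S C}) {h : Set Sphere2 → ℝ≥0∞}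
    (hh : carpetMass S h ≠ ⊤) : conformalModulus {γ | pathMassSum S h γ = ⊤} = 0 := by
  simp_rw [pathMassSum_eq_tsum]
  exact conformalModulus_exceptional_eq_zero hq (h := fun i => h i.1) hh

section Orbit

variable {S : Set Sphere2} {G : Set (S ≃ₜ S)}

theorem setImage_refl {C : Set Sphere2} (hC : C ⊆ S) :
    setImage S (Homeomorph.refl S) C = C := by
  simp [setImage, hC]

theorem setImage_setImage (g h : S ≃ₜ S) (C : Set Sphere2) :
    setImage S h (setImage S g C) = setImage S (g.trans h) C := by
  rw [setImage, setImage, preimage_image_eq _ Subtype.val_injective, setImage, image_image,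
    image_image, image_image]
  rfl

theorem mem_periphOrbit_self (hG : IsHomeoGroup S G) {C : Set Sphere2} (hC : C ⊆ S) :
    C ∈ periphOrbit S G C :=
  ⟨_, hG.1, (setImage_refl hC).symm⟩

theorem periphOrbit_setImage (hG : IsHomeoGroup S G) {g : S ≃ₜ S} (hg : g ∈ G)
    (C : Set Sphere2) : periphOrbit S G (setImage S g C) = periphOrbit S G C := by
  ext D
  constructor
  · rintro ⟨h, hh, rfl⟩
    exact ⟨_, hG.2.1 g hg h hh, setImage_setImage g h C⟩
  · rintro ⟨h, hh, rfl⟩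
    refine ⟨g.symm.trans h, hG.2.1 _ (hG.2.2 g hg) h hh, ?_⟩
    rw [setImage_setImage]
    congr 1
    ext z
    simp

open Classical in
/-- The invariant mass distribution with prescribed values on the orbits. -/
noncomputable def orbitLift (S : Set Sphere2) (G : Set (S ≃ₜ S))
    (w : periphOrbitSet S G → ℝ≥0∞) (C : Set Sphere2) : ℝ≥0∞ :=
  if h : periphOrbit S G C ∈ periphOrbitSet S G then w ⟨_, h⟩ else 0

theorem orbitLift_apply (w : periphOrbitSet S G → ℝ≥0∞) {C : Set Sphere2}
    (hC : IsPeripheralCircle S C) :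
    orbitLift S G w C = w ⟨periphOrbit S G C, C, hC, rfl⟩ :=
  dif_pos _

theorem orbitLift_of_eq (w : periphOrbitSet S G → ℝ≥0∞) {C : Set Sphere2}
    (O : periphOrbitSet S G) (h : periphOrbit S G C = O) : orbitLift S G w C = w O := by
  obtain ⟨O, hO⟩ := O
  subst h
  exact dif_pos hO

theorem invariantMass_orbitLift (hG : IsHomeoGroup S G) (w : periphOrbitSet S G → ℝ≥0∞) :
    InvariantMass S G (orbitLift S G w) := by
  intro g hg C hC
  rw [orbitLift_apply w hC]
  exact orbitLift_of_eq w ⟨_, C, hC, rfl⟩ (periphOrbit_setImage hG hg C)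

theorem groupMass_orbitLift (hG : IsHomeoGroup S G) (w : periphOrbitSet S G → ℝ≥0∞) :
    groupMass S G (orbitLift S G w) = ∑' O, w O ^ 2 := by
  refine tsum_congr fun O => ?_
  obtain ⟨C, hC, hO⟩ := O.2
  refine le_antisymm (iSup₂_le fun D hD => ?_) ?_
  · rw [hO] at hD
    obtain ⟨g, hg, rfl⟩ := hD
    rw [orbitLift_of_eq w O ((periphOrbit_setImage hG hg C).trans hO.symm)]
  · refine le_iSup₂_of_le C (hO ▸ mem_periphOrbit_self hG hC.1) ?_
    rw [orbitLift_of_eq w O hO.symm]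

theorem InvariantMass.exists_orbitLift {ρ : Set Sphere2 → ℝ≥0∞} (hρ : InvariantMass S G ρ)
    (hG : IsHomeoGroup S G) :
    ∃ w : periphOrbitSet S G → ℝ≥0∞, groupMass S G ρ = ∑' O, w O ^ 2 ∧
      ∀ C, IsPeripheralCircle S C → ρ C = orbitLift S G w C := by
  have hval : ∀ C, IsPeripheralCircle S C → ∀ D ∈ periphOrbit S G C, ρ D = ρ C := by
    rintro C hC _ ⟨g, hg, rfl⟩
    exact hρ g hg C hC
  refine ⟨fun O => ⨆ C ∈ O.1, ρ C, tsum_congr fun O => ?_, fun C hC => ?_⟩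
  · simp_rw [ENNReal.iSup_sq]
  · rw [orbitLift_apply _ hC]
    refine le_antisymm (le_iSup₂_of_le C (mem_periphOrbit_self hG hC.1) le_rfl)
      (iSup₂_le fun D hD => (hval C hC D hD).le)

/-- A weight on the orbits that is square summable is square summable over any family of circles
that meets each orbit in a bounded number of circles. -/
theorem carpetMass_indicator_orbitLift_le (hG : IsHomeoGroup S G) {𝒞 : Set (Set Sphere2)} {N : ℕ}
    (hbound : ∀ O ∈ periphOrbitSet S G, (O ∩ 𝒞).encard ≤ (N : ℕ∞))
    (w : periphOrbitSet S G → ℝ≥0∞) :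
    carpetMass S (𝒞.indicator (orbitLift S G w)) ≤ N * ∑' O, w O ^ 2 := by
  calc carpetMass S (𝒞.indicator (orbitLift S G w))
      ≤ ∑' C : {C // IsPeripheralCircle S C}, ∑' O : periphOrbitSet S G,
          (O.1 ∩ 𝒞).indicator (fun _ => 1) C.1 * w O ^ 2 := by
        refine ENNReal.tsum_le_tsum fun C => ?_
        by_cases hC : C.1 ∈ 𝒞
        · refine le_trans (le_of_eq ?_)
            (ENNReal.le_tsum (⟨periphOrbit S G C.1, C.1, C.2, rfl⟩ : periphOrbitSet S G))
          rw [indicator_of_mem hC, orbitLift_apply w C.2,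
            indicator_of_mem (mem_inter (mem_periphOrbit_self hG C.2.1) hC), one_mul]
        · simp [indicator_of_notMem hC]
    _ = ∑' O : periphOrbitSet S G, (∑' C : {C // IsPeripheralCircle S C},
          (O.1 ∩ 𝒞).indicator (fun _ => (1 : ℝ≥0∞)) C.1) * w O ^ 2 := by
        rw [ENNReal.tsum_comm]
        simp_rw [ENNReal.tsum_mul_right]
    _ ≤ ∑' O : periphOrbitSet S G, N * w O ^ 2 := by
        refine ENNReal.tsum_le_tsum fun O => mul_le_mul_left ?_ _
        refine (ENNReal.tsum_comp_le_tsum_of_injective Subtype.val_injective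
          ((O.1 ∩ 𝒞).indicator fun _ => (1 : ℝ≥0∞))).trans ?_
        rw [← tsum_subtype, ENNReal.tsum_set_one]
        exact_mod_cast hbound O.1 O.2
    _ = N * ∑' O, w O ^ 2 := ENNReal.tsum_mul_left

end Orbit

theorem exists_sq_summable_dominating {Ω : Type*} {d : ℕ → Ω → ℝ≥0∞}
    (hd : ∀ n, ∑' O, d n O ^ 2 ≤ (8 : ℝ≥0∞)⁻¹ ^ n) :
    ∃ h : Ω → ℝ≥0∞, ∑' O, h O ^ 2 ≠ ⊤ ∧ ∀ n O, d n O ≤ (2 : ℝ≥0∞)⁻¹ ^ n * h O := by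
  have htwo : ∀ n : ℕ, (2 : ℝ≥0∞)⁻¹ ^ n * 2 ^ n = 1 := fun n => by
    rw [← mul_pow, ENNReal.inv_mul_cancel (by simp) (by simp), one_pow]
  have hfour : (4 : ℝ≥0∞) * 8⁻¹ = 2⁻¹ := by
    rw [show (8 : ℝ≥0∞) = 4 * 2 by norm_num, ENNReal.mul_inv (by simp) (by simp), ← mul_assoc,
      ENNReal.mul_inv_cancel (by simp) (by simp), one_mul]
  set H : Ω → ℝ≥0∞ := fun O => ∑' n, 4 ^ n * d n O ^ 2 with hH
  have hsq : ∀ O, (H O ^ ((2 : ℕ) : ℝ)⁻¹) ^ 2 = H O := fun O =>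
    ENNReal.rpow_inv_natCast_pow two_ne_zero (H O)
  refine ⟨fun O => H O ^ ((2 : ℕ) : ℝ)⁻¹, ?_, fun n O => ?_⟩
  · simp_rw [hsq, hH]
    rw [ENNReal.tsum_comm]
    refine ne_top_of_le_ne_top (b := ∑' n : ℕ, (2 : ℝ≥0∞)⁻¹ ^ n) ?_
      (ENNReal.tsum_le_tsum fun n => ?_)
    · rw [ENNReal.tsum_geometric]; simp
    · rw [ENNReal.tsum_mul_left, ← hfour, mul_pow]
      gcongr
      exact hd n
  · have h1 : 2 ^ n * d n O ≤ H O ^ ((2 : ℕ) : ℝ)⁻¹ := by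
      rw [ENNReal.le_rpow_inv_iff (by norm_num), ENNReal.rpow_natCast, mul_pow, ← pow_mul,
        mul_comm n, pow_mul]
      refine le_trans (le_of_eq ?_) (ENNReal.le_tsum n)
      norm_num
    calc d n O = (2 : ℝ≥0∞)⁻¹ ^ n * (2 ^ n * d n O) := by rw [← mul_assoc, htwo, one_mul]
      _ ≤ _ := by gcongr

theorem pathMassSum_mono {S : Set Sphere2} {ρ ρ' : Set Sphere2 → ℝ≥0∞} {γ : SpherePath}
    (h : ∀ C, IsPeripheralCircle S C → (γ.image ∩ C).Nonempty → ρ C ≤ ρ' C) :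
    pathMassSum S ρ γ ≤ pathMassSum S ρ' γ :=
  ENNReal.tsum_le_tsum fun C => h C.1 C.2.1 C.2.2

theorem pathMassSum_add (S : Set Sphere2) (ρ ρ' : Set Sphere2 → ℝ≥0∞) (γ : SpherePath) :
    pathMassSum S (fun C => ρ C + ρ' C) γ = pathMassSum S ρ γ + pathMassSum S ρ' γ :=
  ENNReal.tsum_add

theorem pathMassSum_const_mul (S : Set Sphere2) (c : ℝ≥0∞) (ρ : Set Sphere2 → ℝ≥0∞)
    (γ : SpherePath) : pathMassSum S (fun C => c * ρ C) γ = c * pathMassSum S ρ γ :=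
  ENNReal.tsum_mul_left

theorem CarpetAdmissible.mono {S : Set Sphere2} {Γ : Set SpherePath} {ρ ρ' : Set Sphere2 → ℝ≥0∞}
    (hρ : CarpetAdmissible S Γ ρ) (h : ∀ C, IsPeripheralCircle S C → ρ C ≤ ρ' C) :
    CarpetAdmissible S Γ ρ' := by
  obtain ⟨Γ₀, h1, h2, h3⟩ := hρ
  exact ⟨Γ₀, h1, h2, fun γ hγ => (h3 γ hγ).trans (pathMassSum_mono fun C hC _ => h C hC)⟩

theorem CarpetAdmissible.convex_comb {S : Set Sphere2} {Γ : Set SpherePath}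
    {ρ ρ' : Set Sphere2 → ℝ≥0∞} (hρ : CarpetAdmissible S Γ ρ) (hρ' : CarpetAdmissible S Γ ρ')
    {s t : ℝ≥0∞} (hst : s + t = 1) : CarpetAdmissible S Γ fun C => s * ρ C + t * ρ' C := by
  obtain ⟨Γ₁, h1, h2, h3⟩ := hρ
  obtain ⟨Γ₂, h1', h2', h3'⟩ := hρ'
  refine ⟨Γ₁ ∪ Γ₂, union_subset h1 h1', conformalModulus_union_eq_zero h2 h2', fun γ hγ => ?_⟩
  rw [pathMassSum_add, pathMassSum_const_mul, pathMassSum_const_mul, ← hst]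
  have e1 := h3 γ ⟨hγ.1, fun h => hγ.2 (Or.inl h)⟩
  have e2 := h3' γ ⟨hγ.1, fun h => hγ.2 (Or.inr h)⟩
  exact add_le_add (le_mul_of_one_le_right' e1) (le_mul_of_one_le_right' e2)

/-- Admissibility of invariant mass distributions is preserved under square-mean approximation. -/
theorem carpetAdmissible_orbitLift_of_approx {S : Set Sphere2}
    (hq : UniformQuasicircles {C | IsPeripheralCircle S C}) {G : Set (S ≃ₜ S)}
    (hG : IsHomeoGroup S G) {Γ : Set SpherePath} {𝒞 : ℕ → Set (Set Sphere2)} {N : ℕ → ℕ}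
    (hbound : ∀ k, ∀ O ∈ periphOrbitSet S G, (O ∩ 𝒞 k).encard ≤ (N k : ℕ∞))
    (hcover : ∀ γ ∈ Γ, ∃ k, ∀ C, IsPeripheralCircle S C → (γ.image ∩ C).Nonempty → C ∈ 𝒞 k)
    {w : periphOrbitSet S G → ℝ≥0∞}
    (happrox : ∀ ε : ℝ≥0∞, ε ≠ 0 → ∃ d : periphOrbitSet S G → ℝ≥0∞,
      ∑' O, d O ^ 2 ≤ ε ∧ CarpetAdmissible S Γ (orbitLift S G fun O => w O + d O)) :
    CarpetAdmissible S Γ (orbitLift S G w) := by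
  choose d hd hadm using fun n : ℕ => happrox ((8 : ℝ≥0∞)⁻¹ ^ n) (by simp)
  choose Γ₀ hsub hmod hmass using hadm
  obtain ⟨h, hh, hdh⟩ := exists_sq_summable_dominating hd
  set E : ℕ → Set SpherePath := fun k =>
    {γ | pathMassSum S ((𝒞 k).indicator (orbitLift S G h)) γ = ⊤} with hE
  have hEmod : ∀ k, conformalModulus (E k) = 0 := fun k =>
    conformalModulus_pathMassSum_eq_top hq (ne_top_of_le_ne_top
      (ENNReal.mul_ne_top (ENNReal.natCast_ne_top _) hh)
      (carpetMass_indicator_orbitLift_le hG (hbound k) h))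
  refine ⟨Γ ∩ ((⋃ n, Γ₀ n) ∪ ⋃ k, E k), inter_subset_left, ?_, ?_⟩
  · exact le_antisymm ((conformalModulus_mono inter_subset_right).trans
      (conformalModulus_union_eq_zero (conformalModulus_iUnion_eq_zero hmod)
        (conformalModulus_iUnion_eq_zero hEmod)).le) zero_le
  · rintro γ ⟨hγ, hγE⟩
    obtain ⟨k, hk⟩ := hcover γ hγ
    have hγn : ∀ n, γ ∉ Γ₀ n := fun n hn => hγE ⟨hγ, Or.inl (mem_iUnion.2 ⟨n, hn⟩)⟩
    have hγk : pathMassSum S (orbitLift S G h) γ ≠ ⊤ := by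
      intro htop
      refine hγE ⟨hγ, Or.inr (mem_iUnion.2 ⟨k, ?_⟩)⟩
      rw [hE, mem_ofPred_eq, eq_top_iff, ← htop]
      exact pathMassSum_mono fun C hC hm => (indicator_of_mem (hk C hC hm) _).ge
    have hle : ∀ n : ℕ, 1 ≤ pathMassSum S (orbitLift S G w) γ +
        (2 : ℝ≥0∞)⁻¹ ^ n * pathMassSum S (orbitLift S G h) γ := by
      intro n
      rw [← pathMassSum_const_mul, ← pathMassSum_add]
      refine (hmass n γ ⟨hγ, hγn n⟩).trans (pathMassSum_mono fun C hC _ => ?_)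
      simp only [orbitLift_apply _ hC]
      gcongr
      exact hdh n _
    have hlim : Tendsto (fun n : ℕ => pathMassSum S (orbitLift S G w) γ +
        (2 : ℝ≥0∞)⁻¹ ^ n * pathMassSum S (orbitLift S G h) γ) atTop
        (𝓝 (pathMassSum S (orbitLift S G w) γ)) := by
      have h1 : Tendsto (fun n : ℕ => (2 : ℝ≥0∞)⁻¹ ^ n) atTop (𝓝 0) :=
        ENNReal.tendsto_pow_atTop_nhds_zero_of_lt_one (by simp)
      simpa using tendsto_const_nhds.add (ENNReal.Tendsto.mul_const h1 (Or.inr hγk))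
    exact ge_of_tendsto' hlim hle

theorem tsum_ofReal_norm_sq {Ω : Type*} (a : lp (fun _ : Ω => ℝ) 2) :
    ∑' O, ENNReal.ofReal ‖a O‖ ^ 2 = ENNReal.ofReal (‖a‖ ^ 2) := by
  have h := lp.hasSum_norm (by norm_num) a
  simp only [ENNReal.toReal_ofNat, Real.rpow_ofNat] at h
  rw [← h.tsum_eq, ENNReal.ofReal_tsum_of_nonneg (fun _ => by positivity) h.summable]
  simp_rw [ENNReal.ofReal_pow (norm_nonneg _)]

theorem exists_lp_of_tsum_sq_ne_top {Ω : Type*} {w : Ω → ℝ≥0∞} (hw : ∑' O, w O ^ 2 ≠ ⊤) :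
    ∃ a : lp (fun _ : Ω => ℝ) 2, ∀ O, 0 ≤ a O ∧ ENNReal.ofReal (a O) = w O := by
  have hwt : ∀ O, w O ≠ ⊤ := fun O hO => ENNReal.ne_top_of_tsum_ne_top hw O (by simp [hO])
  have hmem : Memℓp (fun O => (w O).toReal) 2 := by
    refine memℓp_gen ?_
    simpa using ENNReal.summable_toReal hw
  exact ⟨⟨_, hmem⟩, fun O => ⟨ENNReal.toReal_nonneg, ENNReal.ofReal_toReal (hwt O)⟩⟩

/-- **Existence of an extremal invariant mass distribution for the carpet modulus with
respect to a group** (Proposition 3.2).  Let `S` be a carpet in `S²` whose peripheral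
circles are uniform quasicircles, `G` a group of homeomorphisms of `S`, and `Γ` a path
family in `S²` with `mod_{S/G}(Γ) < ∞`.  Suppose that for each `k ∈ ℕ` there are a
family `𝒞_k` of peripheral circles of `S` and a constant `N_k ∈ ℕ` such that (i) every
orbit `𝒪` of peripheral circles satisfies `#(𝒪 ∩ 𝒞_k) ≤ N_k`, and (ii) `Γ = ⋃_k Γ_k`
where `Γ_k` consists of the paths in `Γ` meeting only peripheral circles from `𝒞_k`.
Then the infimum defining `mod_{S/G}(Γ)` is attained by an invariant admissible mass
distribution. -/
theorem extremal_invariant_mass_distribution_exists (S : Set ↥Sphere2)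
    (hS : IsCarpet S) (hq : UniformQuasicircles {C | IsPeripheralCircle S C})
    (G : Set (↥S ≃ₜ ↥S)) (hG : IsHomeoGroup S G)
    (Γ : Set SpherePath) (hfin : groupCarpetModulus S G Γ < ⊤)
    (𝒞 : ℕ → Set (Set ↥Sphere2)) (N : ℕ → ℕ)
    (h𝒞 : ∀ k, ∀ C ∈ 𝒞 k, IsPeripheralCircle S C)
    (hbound : ∀ k, ∀ O ∈ periphOrbitSet S G, (O ∩ 𝒞 k).encard ≤ (N k : ℕ∞))
    (hcover : Γ = ⋃ k : ℕ, {γ ∈ Γ | ∀ C : Set ↥Sphere2, IsPeripheralCircle S C →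
        (γ.image ∩ C).Nonempty → C ∈ 𝒞 k}) :
    ∃ ρ : Set ↥Sphere2 → ℝ≥0∞, InvariantMass S G ρ ∧ CarpetAdmissible S Γ ρ ∧
      groupMass S G ρ = groupCarpetModulus S G Γ := by
  have hcover' : ∀ γ ∈ Γ,
      ∃ k, ∀ C, IsPeripheralCircle S C → (γ.image ∩ C).Nonempty → C ∈ 𝒞 k := by
    intro γ hγ
    rw [hcover] at hγ
    obtain ⟨k, hk⟩ := mem_iUnion.1 hγ
    exact ⟨k, hk.2⟩
  let mass (a : lp (fun _ : periphOrbitSet S G => ℝ) 2) : Set Sphere2 → ℝ≥0∞ :=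
    orbitLift S G fun O => ENNReal.ofReal (a O)
  let K : Set (lp (fun _ : periphOrbitSet S G => ℝ) 2) :=
    {a | (∀ O, 0 ≤ a O) ∧ CarpetAdmissible S Γ (mass a)}
  have hmassK : ∀ a ∈ K, groupMass S G (mass a) = ENNReal.ofReal (‖a‖ ^ 2) := by
    intro a ha
    rw [groupMass_orbitLift hG, ← tsum_ofReal_norm_sq]
    simp_rw [Real.norm_of_nonneg (ha.1 _)]
  have hrep : ∀ ρ, InvariantMass S G ρ → CarpetAdmissible S Γ ρ → groupMass S G ρ ≠ ⊤ →
      ∃ a ∈ K, groupMass S G ρ = ENNReal.ofReal (‖a‖ ^ 2) := by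
    intro ρ hinv hadm hρ
    obtain ⟨w, hw, hwρ⟩ := hinv.exists_orbitLift hG
    obtain ⟨a, ha⟩ := exists_lp_of_tsum_sq_ne_top (hw ▸ hρ)
    have hmass : mass a = orbitLift S G w := by simp only [mass, (ha _).2]
    have haK : a ∈ K := ⟨fun O => (ha O).1, hadm.mono fun C hC => by rw [hmass, hwρ C hC]⟩
    exact ⟨a, haK, by rw [← hmassK a haK, hmass, groupMass_orbitLift hG, hw]⟩
  have hne : K.Nonempty := by
    obtain ⟨ρ, hρ⟩ := iInf_lt_iff.1 hfin
    obtain ⟨hinv, hρ⟩ := iInf_lt_iff.1 hρ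
    obtain ⟨hadm, hρ⟩ := iInf_lt_iff.1 hρ
    obtain ⟨a, ha, -⟩ := hrep ρ hinv hadm hρ.ne
    exact ⟨a, ha⟩
  have hconv : Convex ℝ K := by
    intro a ha b hb s t hs ht hst
    refine ⟨fun O => add_nonneg (mul_nonneg hs (ha.1 O)) (mul_nonneg ht (hb.1 O)), ?_⟩
    refine (ha.2.convex_comb hb.2 (s := ENNReal.ofReal s) (t := ENNReal.ofReal t)
      (by rw [← ENNReal.ofReal_add hs ht, hst, ENNReal.ofReal_one])).mono fun C hC => ?_
    simp only [mass, orbitLift_apply _ hC]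
    rw [← ENNReal.ofReal_mul hs, ← ENNReal.ofReal_mul ht,
      ← ENNReal.ofReal_add (mul_nonneg hs (ha.1 _)) (mul_nonneg ht (hb.1 _))]
    rfl
  have hclosed : IsClosed K := by
    refine isClosed_of_closure_subset fun a ha => ⟨fun O => ?_, ?_⟩
    · refine le_of_forall_pos_lt_add fun ε hε => ?_
      obtain ⟨b, hb, hab⟩ := Metric.mem_closure_iff.1 ha ε hε
      have h1 := lp.norm_apply_le_norm (by simp) (a - b) O
      rw [← dist_eq_norm, lp.coeFn_sub, Pi.sub_apply, Real.norm_eq_abs] at h1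
      have h2 := hb.1 O
      have h3 := neg_abs_le (a O - b O)
      linarith
    · refine carpetAdmissible_orbitLift_of_approx hq hG hbound hcover' fun ε hε => ?_
      obtain ⟨δ, hδ, hδε⟩ : ∃ δ : ℝ, 0 < δ ∧ ENNReal.ofReal (δ ^ 2) ≤ ε := by
        rcases eq_or_ne ε ⊤ with rfl | hεt
        · exact ⟨1, one_pos, le_top⟩
        · have := ENNReal.toReal_pos hε hεt
          refine ⟨√ε.toReal, Real.sqrt_pos.2 this, ?_⟩
          rw [Real.sq_sqrt this.le, ENNReal.ofReal_toReal hεt]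
      obtain ⟨b, hb, hab⟩ := Metric.mem_closure_iff.1 ha δ hδ
      refine ⟨fun O => ENNReal.ofReal ‖(b - a) O‖, ?_, hb.2.mono fun C hC => ?_⟩
      · rw [tsum_ofReal_norm_sq, ← dist_eq_norm, dist_comm]
        refine (ENNReal.ofReal_le_ofReal ?_).trans hδε
        gcongr
      · simp only [mass, orbitLift_apply _ hC]
        refine le_trans (ENNReal.ofReal_le_ofReal ?_) ENNReal.ofReal_add_le
        rw [lp.coeFn_sub, Pi.sub_apply, Real.norm_eq_abs]
        have := le_abs_self (b ⟨periphOrbit S G C, C, hC, rfl⟩ -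
          a ⟨periphOrbit S G C, C, hC, rfl⟩)
        linarith
  obtain ⟨a, haK, hmin⟩ :=
    exists_norm_eq_iInf_of_complete_convex hne hclosed.isComplete hconv 0
  have hle : ∀ b ∈ K, ‖a‖ ≤ ‖b‖ := by
    intro b hb
    have h1 : ⨅ v : K, ‖0 - (v : lp (fun _ : periphOrbitSet S G => ℝ) 2)‖ ≤ ‖0 - b‖ :=
      ciInf_le ⟨0, by rintro _ ⟨v, rfl⟩; exact norm_nonneg _⟩ (⟨b, hb⟩ : K)
    rw [← hmin] at h1
    simpa using h1
  refine ⟨mass a, invariantMass_orbitLift hG _, haK.2, le_antisymm ?_ ?_⟩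
  · refine le_iInf fun ρ => le_iInf fun hinv => le_iInf fun hadm => ?_
    rcases eq_or_ne (groupMass S G ρ) ⊤ with htop | hρ
    · rw [htop]; exact le_top
    · obtain ⟨b, hb, hbρ⟩ := hrep ρ hinv hadm hρ
      rw [hbρ, hmassK a haK]
      have := hle b hb
      gcongr
  · exact iInf_le_of_le (mass a) (iInf₂_le_of_le (invariantMass_orbitLift hG _) haK.2 le_rfl)
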